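/- arXiv:2208.13060 — 2 statements merged into one kernel-verified Lean document; each statement's English description precedes it below -/
import Mathlib

section
/- Fix N ≥ 1. For i = 1, …, r, let χ₁⁽ⁱ⁾, χ₂⁽ⁱ⁾ be primitive Dirichlet characters modulo q₁⁽ⁱ⁾ and q₂⁽ⁱ⁾ respectively, with q₁⁽ⁱ⁾, q₂⁽ⁱ⁾ > 1, q₁⁽ⁱ⁾·q₂⁽ⁱ⁾ = N, and χ₁⁽ⁱ⁾(−1)χ₂⁽ⁱ⁾(−1) = 1, and assume the ordered pairs (χ₁⁽ⁱ⁾, χ₂⁽ⁱ⁾) are pairwise distinct. If complex numbers c₁, …, c_r satisfy Σ_{i=1}^{r} c_i · S_{χ₁⁽ⁱ⁾,χ₂⁽ⁱ⁾}(γ) = 0 for every γ ∈ Γ₁(N), then c_i = 0 for all i. That is, the newform Dedekind sums are linearly independent elements of Hom(Γ₁(N), ℂ). -/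
open scoped BigOperators

/-- The sawtooth (first Bernoulli) function `B₁`. -/
noncomputable def sawtooth (x : ℝ) : ℝ :=
  open scoped Classical in
  if ∃ n : ℤ, x = (n : ℝ) then 0 else x - ⌊x⌋ - 1 / 2

/-- The newform Dedekind sum `S_{χ₁,χ₂}(h,k)`. -/
noncomputable def newformDedekindSum {q₁ q₂ : ℕ} (χ₁ : DirichletCharacter ℂ q₁)
    (χ₂ : DirichletCharacter ℂ q₂) (h k : ℤ) : ℂ :=
  ∑ j ∈ Finset.range k.toNat, ∑ n ∈ Finset.range q₁,
    (starRingEnd ℂ) (χ₂ (j : ZMod q₂)) * (starRingEnd ℂ) (χ₁ (n : ZMod q₁)) *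
      (sawtooth ((j : ℝ) / (k : ℝ)) : ℝ) *
      (sawtooth ((n : ℝ) / (q₁ : ℝ) + (h : ℝ) * (j : ℝ) / (k : ℝ)) : ℝ)

/-- The newform Dedekind sum of a matrix `γ`, via its left column. -/
noncomputable def SGamma {q₁ q₂ : ℕ} (χ₁ : DirichletCharacter ℂ q₁)
    (χ₂ : DirichletCharacter ℂ q₂) (γ : Matrix.SpecialLinearGroup (Fin 2) ℤ) : ℂ :=
  if 0 < (γ : Matrix (Fin 2) (Fin 2) ℤ) 1 0 then
    newformDedekindSum χ₁ χ₂ ((γ : Matrix (Fin 2) (Fin 2) ℤ) 0 0)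
      ((γ : Matrix (Fin 2) (Fin 2) ℤ) 1 0)
  else if (γ : Matrix (Fin 2) (Fin 2) ℤ) 1 0 < 0 then
    newformDedekindSum χ₁ χ₂ (-(γ : Matrix (Fin 2) (Fin 2) ℤ) 0 0)
      (-(γ : Matrix (Fin 2) (Fin 2) ℤ) 1 0)
  else 0

open scoped Real

lemma sum_range_mul_eq_sum_sum {A : Type*} [AddCommMonoid A] (f : ℕ → A) (a b : ℕ) :
    ∑ j ∈ Finset.range (a * b), f j =
      ∑ r ∈ Finset.range a, ∑ l ∈ Finset.range b, f (r + a * l) := by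
  rw [Finset.sum_comm]
  induction b with
  | zero => simp
  | succ b ih =>
    rw [Nat.mul_succ, Finset.sum_range_add, ih, Finset.sum_range_succ]
    simp only [add_comm]

lemma sum_range_natCast_zmod {A : Type*} [AddCommMonoid A] (q : ℕ) [NeZero q] (f : ZMod q → A) :
    ∑ n ∈ Finset.range q, f n = ∑ a, f a := by
  refine Finset.sum_bij' (fun n _ ↦ (n : ZMod q)) (fun a _ ↦ a.val) ?_ ?_ ?_ ?_ ?_
  · simp
  · exact fun a _ ↦ Finset.mem_range.2 a.val_lt
  · exact fun n hn ↦ ZMod.val_cast_of_lt (Finset.mem_range.1 hn)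
  · simp
  · simp

lemma sawtooth_add_intCast (x : ℝ) (n : ℤ) : sawtooth (x + n) = sawtooth x := by
  have h : (∃ m : ℤ, x + n = m) ↔ ∃ m : ℤ, x = m :=
    ⟨fun ⟨m, hm⟩ ↦ ⟨m - n, by push_cast; linarith⟩, fun ⟨m, hm⟩ ↦ ⟨m + n, by push_cast; linarith⟩⟩
  unfold sawtooth
  by_cases hx : ∃ m : ℤ, x = m
  · rw [if_pos (h.2 hx), if_pos hx]
  · rw [if_neg (mt h.1 hx), if_neg hx, Int.floor_add_intCast]
    push_cast
    ring

lemma sawtooth_of_mem_Ioo {x : ℝ} (h₀ : 0 < x) (h₁ : x < 1) : sawtooth x = x - 1 / 2 := by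
  have hx : ¬ ∃ n : ℤ, x = n := by
    rintro ⟨n, rfl⟩
    norm_cast at h₀ h₁
    omega
  have : ⌊x⌋ = 0 := Int.floor_eq_iff.2 ⟨by simpa using h₀.le, by simpa using h₁⟩
  simp [sawtooth, hx, this]

lemma sum_range_add_mul_add (m : ℕ) (a b : ℝ) :
    ∑ l ∈ Finset.range m, (l + a) * (l + b) =
      m * (m - 1) * (2 * m - 1) / 6 + (a + b) * (m * (m - 1) / 2) + m * a * b := by
  induction m with
  | zero => simp
  | succ m ih =>
    rw [Finset.sum_range_succ, ih]
    push_cast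
    ring

lemma sum_sawtooth_mul_sawtooth_of_lt {M p : ℕ} (hp : p < M) {α : ℝ} (h₀ : 0 < α) (h₁ : α < 1) :
    ∑ l ∈ Finset.range M, sawtooth ((l + α) / M) * sawtooth ((l + α) / M + p / M) =
      ∑ l ∈ Finset.range M, sawtooth ((l + α) / M) * sawtooth ((l + α) / M) +
        M / 2 * (((p : ℝ) / M) ^ 2 - p / M) := by
  obtain ⟨m, rfl⟩ := Nat.exists_eq_add_of_le hp.le
  have hm : 0 < m := by omega
  have hM : (0 : ℝ) < p + m := by positivity
  have hs (l : ℕ) (hl : l < p + m) :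
      sawtooth ((l + α) / (p + m : ℕ)) = (l + α) / (p + m : ℕ) - 1 / 2 := by
    have : (l : ℝ) + 1 ≤ p + m := by exact_mod_cast hl
    refine sawtooth_of_mem_Ioo (by push_cast; positivity) ?_
    push_cast
    rw [div_lt_one hM]
    linarith
  have key (D a b : ℝ) (hD : D ≠ 0) (n : ℕ) : ∑ l ∈ Finset.range n,
      ((l + a) / D - 1 / 2) * ((l + b) / D - 1 / 2) =
      (n * (n - 1) * (2 * n - 1) / 6 + ((a - D / 2) + (b - D / 2)) * (n * (n - 1) / 2) +
        n * (a - D / 2) * (b - D / 2)) / D ^ 2 := by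
    rw [← sum_range_add_mul_add, Finset.sum_div]
    refine Finset.sum_congr rfl fun l _ ↦ ?_
    field_simp
    ring
  have hR : ∑ l ∈ Finset.range (p + m), sawtooth ((l + α) / (p + m : ℕ)) *
      sawtooth ((l + α) / (p + m : ℕ)) = ∑ l ∈ Finset.range (p + m),
      ((l + α) / ((p : ℝ) + m) - 1 / 2) * ((l + α) / ((p : ℝ) + m) - 1 / 2) := by
    refine Finset.sum_congr rfl fun l hl ↦ ?_
    rw [hs l (Finset.mem_range.1 hl)]
    push_cast
    rfl
  have hL₁ : ∑ l ∈ Finset.range m, sawtooth ((l + α) / (p + m : ℕ)) *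
      sawtooth ((l + α) / (p + m : ℕ) + p / (p + m : ℕ)) = ∑ l ∈ Finset.range m,
      ((l + α) / ((p : ℝ) + m) - 1 / 2) * ((l + (p + α)) / ((p : ℝ) + m) - 1 / 2) := by
    refine Finset.sum_congr rfl fun l hl ↦ ?_
    have hl := Finset.mem_range.1 hl
    have h := hs (p + l) (by omega)
    rw [hs l (by omega), ← add_div, show (l : ℝ) + α + p = (p + l : ℕ) + α by push_cast; ring, h]
    push_cast
    ring
  have hL₂ : ∑ l ∈ Finset.range p, sawtooth (((m + l : ℕ) + α) / (p + m : ℕ)) *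
      sawtooth (((m + l : ℕ) + α) / (p + m : ℕ) + p / (p + m : ℕ)) = ∑ l ∈ Finset.range p,
      ((l + (m + α)) / ((p : ℝ) + m) - 1 / 2) * ((l + α) / ((p : ℝ) + m) - 1 / 2) := by
    refine Finset.sum_congr rfl fun l hl ↦ ?_
    have hl := Finset.mem_range.1 hl
    rw [hs (m + l) (by omega), show (((m + l : ℕ) : ℝ) + α) / (p + m : ℕ) + p / (p + m : ℕ) =
      (l + α) / (p + m : ℕ) + (1 : ℤ) by push_cast; field_simp; ring, sawtooth_add_intCast,
      hs l (by omega)]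
    push_cast
    ring
  rw [hR, show Finset.range (p + m) = Finset.range (m + p) by rw [add_comm], Finset.sum_range_add,
    hL₁, hL₂, key _ _ _ hM.ne', key _ _ _ hM.ne', key _ _ _ hM.ne']
  push_cast
  field_simp
  ring

/-- The correlation of two shifted sawtooth samples along an arithmetic progression. -/
lemma sum_sawtooth_mul_sawtooth {M : ℕ} (hM : 0 < M) (p : ℤ) {α : ℝ} (h₀ : 0 < α) (h₁ : α < 1) :
    ∑ l ∈ Finset.range M, sawtooth ((l + α) / M) * sawtooth ((l + α) / M + p / M) =
      ∑ l ∈ Finset.range M, sawtooth ((l + α) / M) * sawtooth ((l + α) / M) +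
        M / 2 * (Int.fract ((p : ℝ) / M) ^ 2 - Int.fract ((p : ℝ) / M)) := by
  obtain ⟨s, hs⟩ := Int.eq_ofNat_of_zero_le
    (Int.emod_nonneg p (by exact_mod_cast hM.ne' : (M : ℤ) ≠ 0))
  have hsM : s < M := by
    have := Int.emod_lt_of_pos p (by exact_mod_cast hM : (0 : ℤ) < M)
    omega
  have hM' : (0 : ℝ) < M := by exact_mod_cast hM
  have hp : (p : ℝ) / M = s / M + (p / M : ℤ) := by
    have h := Int.emod_add_mul_ediv p M
    rw [hs] at h
    have h : (s : ℝ) + M * (p / M : ℤ) = p := by exact_mod_cast h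
    rw [← h]
    field_simp
  have hfr : Int.fract ((s : ℝ) / M) = s / M :=
    Int.fract_eq_self.2 ⟨by positivity, (div_lt_one hM').2 (by exact_mod_cast hsM)⟩
  simp only [hp, ← add_assoc, sawtooth_add_intCast, Int.fract_add_intCast, hfr]
  exact sum_sawtooth_mul_sawtooth_of_lt hsM h₀ h₁

lemma ne_one_of_isPrimitive {q : ℕ} (hq : 1 < q) {χ : DirichletCharacter ℂ q}
    (hχ : χ.IsPrimitive) : χ ≠ 1 := by
  have : NeZero q := ⟨by omega⟩
  rintro rfl
  rw [DirichletCharacter.isPrimitive_def, DirichletCharacter.conductor_one] at hχ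
  omega

lemma sum_range_conj_eq_zero {q : ℕ} (hq : 1 < q) {χ : DirichletCharacter ℂ q}
    (hχ : χ.IsPrimitive) : ∑ n ∈ Finset.range q, (starRingEnd ℂ) (χ n) = 0 := by
  have : NeZero q := ⟨by omega⟩
  rw [← map_sum, sum_range_natCast_zmod q (fun a ↦ χ a),
    MulChar.sum_eq_zero_of_ne_one (ne_one_of_isPrimitive hq hχ), map_zero]

/-- The newform Dedekind sum at a parabolic matrix fixing the cusp `u / v`. -/
lemma newformDedekindSum_parabolic {q₁ q₂ u v : ℕ} (hq₁ : 1 < q₁) (hq₂ : 1 < q₂) (hv : 0 < v)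
    {χ₁ : DirichletCharacter ℂ q₁} (χ₂ : DirichletCharacter ℂ q₂) (hχ₁ : χ₁.IsPrimitive) :
    newformDedekindSum χ₁ χ₂ (1 + ((q₁ * q₂ : ℕ) : ℤ) ^ 2 * u * v)
        ((v * (q₁ * q₂ : ℕ) : ℤ) ^ 2) =
      (v * (q₁ * q₂ : ℕ) : ℕ) / 2 * ∑ r ∈ Finset.range (v * (q₁ * q₂)), ∑ n ∈ Finset.range q₁,
        (starRingEnd ℂ) (χ₂ r) * (starRingEnd ℂ) (χ₁ n) *
          (bernoulliFun 2 (Int.fract ((n : ℝ) / q₁ + u * r / v)) : ℝ) := by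
  obtain ⟨M, hM⟩ : ∃ M, M = v * (q₁ * q₂) := ⟨_, rfl⟩
  have hM₀ : 0 < M := by rw [hM]; positivity
  have hMR : (M : ℝ) = v * (q₁ * q₂) := by rw [hM]; push_cast; ring
  have hM' : (0 : ℝ) < M := by exact_mod_cast hM₀
  have hv' : (v : ℝ) ≠ 0 := by positivity
  have hq₁' : (q₁ : ℝ) ≠ 0 := by positivity
  have hq₂' : (q₂ : ℝ) ≠ 0 := by positivity
  have hk : ((v * (q₁ * q₂ : ℕ) : ℤ) ^ 2) = ((M * M : ℕ) : ℤ) := by rw [hM]; push_cast; ring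
  rw [newformDedekindSum, hk, Int.toNat_natCast, sum_range_mul_eq_sum_sum, ← hM, Finset.mul_sum]
  refine Finset.sum_congr rfl fun r hr ↦ ?_
  rw [Finset.sum_comm]
  rcases eq_or_ne r 0 with rfl | hr₀
  · have : (M : ZMod q₂) = 0 := by
      rw [ZMod.natCast_eq_zero_iff, hM]
      exact ⟨v * q₁, by ring⟩
    have h0 : χ₂ 0 = 0 := DirichletCharacter.map_zero' χ₂ (by omega)
    simp [this, h0]
  set α : ℝ := r / M with hα
  have hα₀ : 0 < α := by positivity
  have hα₁ : α < 1 := (div_lt_one hM').2 (by exact_mod_cast Finset.mem_range.1 hr)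
  have hχ₂ (l : ℕ) : χ₂ ((r + M * l : ℕ) : ZMod q₂) = χ₂ r := by
    have : (M : ZMod q₂) = 0 := by
      rw [ZMod.natCast_eq_zero_iff, hM]
      exact ⟨v * q₁, by ring⟩
    simp [this]
  have h₁ (l : ℕ) : ((r + M * l : ℕ) : ℝ) / ((M * M : ℕ) : ℤ) = (l + α) / M := by
    rw [hα]
    push_cast
    field_simp
    ring
  obtain ⟨p, hp⟩ : ∃ p : ℕ → ℤ, ∀ n, p n = n * v * q₂ + u * r * (q₁ * q₂) := ⟨_, fun _ ↦ rfl⟩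
  have h₂ (n l : ℕ) : sawtooth ((n : ℝ) / q₁ +
      ((1 + ((q₁ * q₂ : ℕ) : ℤ) ^ 2 * u * v : ℤ) : ℝ) * ((r + M * l : ℕ) : ℝ) /
        ((M * M : ℕ) : ℤ)) =
      sawtooth ((l + α) / M + p n / M) := by
    rw [← sawtooth_add_intCast ((l + α) / M + p n / M) (u * (q₁ * q₂) * l), hα, hp]
    congr 1
    push_cast
    rw [hMR]
    field_simp
    ring
  have h₃ (n : ℕ) : (p n : ℝ) / M = n / q₁ + u * r / v := by
    rw [hMR, hp]
    push_cast
    field_simp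
  have hin (n : ℕ) : ∑ l ∈ Finset.range M, (starRingEnd ℂ) (χ₂ ((r + M * l : ℕ) : ZMod q₂)) *
      (starRingEnd ℂ) (χ₁ (n : ZMod q₁)) *
      (sawtooth (((r + M * l : ℕ) : ℝ) / ((M * M : ℕ) : ℤ)) : ℝ) *
      (sawtooth ((n : ℝ) / q₁ + ((1 + ((q₁ * q₂ : ℕ) : ℤ) ^ 2 * u * v : ℤ) : ℝ) *
        ((r + M * l : ℕ) : ℝ) / ((M * M : ℕ) : ℤ)) : ℝ) =
      (starRingEnd ℂ) (χ₁ n) * ((starRingEnd ℂ) (χ₂ r) *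
        ((∑ l ∈ Finset.range M, sawtooth ((l + α) / M) * sawtooth ((l + α) / M) - M / 2 * 6⁻¹ :
          ℝ) : ℂ)) +
      (M : ℂ) / 2 * ((starRingEnd ℂ) (χ₂ r) * (starRingEnd ℂ) (χ₁ n) *
        (bernoulliFun 2 (Int.fract ((n : ℝ) / q₁ + u * r / v)) : ℝ)) := by
    simp only [hχ₂, h₁, h₂]
    simp only [mul_assoc, ← Finset.mul_sum, ← Complex.ofReal_mul,
      ← Complex.ofReal_sum, sum_sawtooth_mul_sawtooth hM₀ _ hα₀ hα₁]
    simp only [h₃, bernoulliFun_two]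
    push_cast
    ring
  simp only [hin]
  rw [Finset.sum_add_distrib, ← Finset.sum_mul, sum_range_conj_eq_zero hq₁ hχ₁, zero_mul, zero_add,
    ← Finset.mul_sum]

lemma hasSum_bernoulliFun_two_fract (y : ℝ) :
    HasSum (fun m : ℤ ↦ 1 / (m : ℂ) ^ 2 * Complex.exp (2 * π * Complex.I * (m * y)))
      (2 * (π : ℂ) ^ 2 * (bernoulliFun 2 (Int.fract y) : ℝ)) := by
  have h := hasSum_one_div_pow_mul_fourier_mul_bernoulliFun le_rfl
    (x := Int.fract y) ⟨Int.fract_nonneg y, (Int.fract_lt_one y).le⟩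
  convert! h using 2 with m
  · rw [fourier_coe_apply]
    congr 1
    rw [Complex.exp_eq_exp_iff_exists_int]
    refine ⟨m * ⌊y⌋, ?_⟩
    have : ((Int.fract y : ℝ) : ℂ) = y - ⌊y⌋ := by rw [← Int.self_sub_floor]; push_cast; rfl
    rw [this]
    push_cast
    ring
  · rw [mul_pow, mul_pow, Complex.I_sq]
    simp
    ring

/-- The Gauss sum of the conjugate of `χ`, twisted by an integer. -/
noncomputable def conjGaussSum {q : ℕ} (χ : DirichletCharacter ℂ q) (t : ℤ) : ℂ :=
  ∑ r ∈ Finset.range q, (starRingEnd ℂ) (χ r) * Complex.exp (2 * π * Complex.I * (t * r / q))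

lemma conjGaussSum_eq_gaussSum {q : ℕ} [NeZero q] (χ : DirichletCharacter ℂ q) (t : ℤ) :
    conjGaussSum χ t = gaussSum χ⁻¹ (ZMod.stdAddChar.mulShift (t : ZMod q)) := by
  rw [conjGaussSum, gaussSum, ← sum_range_natCast_zmod]
  refine Finset.sum_congr rfl fun r _ ↦ ?_
  rw [AddChar.mulShift_apply, ← MulChar.star_apply', show (t : ZMod q) * r = ((t * r : ℤ) : ZMod q)
    by push_cast; rfl, ZMod.stdAddChar_coe]
  congr 2
  push_cast
  ring

lemma isPrimitive_inv {q : ℕ} {χ : DirichletCharacter ℂ q} (hχ : χ.IsPrimitive) :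
    χ⁻¹.IsPrimitive := by
  rwa [DirichletCharacter.isPrimitive_def, DirichletCharacter.conductor_inv]

lemma conjGaussSum_eq_mul {q : ℕ} [NeZero q] {χ : DirichletCharacter ℂ q} (hχ : χ.IsPrimitive)
    (t : ℤ) : conjGaussSum χ t = χ t * conjGaussSum χ 1 := by
  rw [conjGaussSum_eq_gaussSum, conjGaussSum_eq_gaussSum,
    gaussSum_mulShift_of_isPrimitive _ (isPrimitive_inv hχ), inv_inv]
  simp

lemma conjGaussSum_one_ne_zero {q : ℕ} [NeZero q] {χ : DirichletCharacter ℂ q}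
    (hχ : χ.IsPrimitive) : conjGaussSum χ 1 ≠ 0 := by
  rw [conjGaussSum_eq_gaussSum, Int.cast_one, AddChar.mulShift_one]
  intro h
  have h0 : ZMod.dft (fun a ↦ χ⁻¹ a) = 0 := by
    ext k
    rw [show (fun a ↦ χ⁻¹ a) = ⇑χ⁻¹ from rfl,
      (isPrimitive_inv hχ).fourierTransform_eq_inv_mul_gaussSum, h, mul_zero, Pi.zero_apply]
  rw [map_eq_zero_iff _ ZMod.dft.injective] at h0
  simpa using congrFun h0 1

lemma sum_range_mul_conj_mul_exp_of_mul_eq {q K v : ℕ} (hq : 0 < q) (hv : 0 < v)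
    (χ : DirichletCharacter ℂ q) {a t : ℤ} (h : a * q = t * v) :
    ∑ r ∈ Finset.range (q * K), (starRingEnd ℂ) (χ r) *
      Complex.exp (2 * π * Complex.I * (a * r / v)) = K * conjGaussSum χ t := by
  have hv' : (v : ℂ) ≠ 0 := by exact_mod_cast hv.ne'
  have hq' : (q : ℂ) ≠ 0 := by exact_mod_cast hq.ne'
  have h' : (a : ℂ) * q = t * v := by exact_mod_cast h
  rw [sum_range_mul_eq_sum_sum, conjGaussSum, Finset.mul_sum]
  refine Finset.sum_congr rfl fun r _ ↦ ?_
  rw [Finset.sum_congr rfl (g := fun _ ↦ (starRingEnd ℂ) (χ r) *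
    Complex.exp (2 * π * Complex.I * (t * r / q))), Finset.sum_const, Finset.card_range,
    nsmul_eq_mul]
  intro l _
  congr 1
  · simp
  · rw [Complex.exp_eq_exp_iff_exists_int]
    refine ⟨t * l, ?_⟩
    have h₁ : (a : ℂ) = t * v / q := by rw [eq_div_iff hq', h']
    rw [h₁]
    push_cast
    field_simp

lemma sum_range_mul_conj_mul_exp_of_not_dvd {q K v : ℕ} (hv : 0 < v) (hK : v ∣ K)
    (χ : DirichletCharacter ℂ q) {a : ℤ} (h : ¬ (v : ℤ) ∣ a * q) :
    ∑ r ∈ Finset.range (q * K), (starRingEnd ℂ) (χ r) *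
      Complex.exp (2 * π * Complex.I * (a * r / v)) = 0 := by
  have hv' : (v : ℂ) ≠ 0 := by exact_mod_cast hv.ne'
  rw [sum_range_mul_eq_sum_sum]
  refine Finset.sum_eq_zero fun r _ ↦ ?_
  set z : ℂ := Complex.exp (2 * π * Complex.I * (a * q / v)) with hz
  have hz₁ : z ≠ 1 := by
    rw [hz, Ne, Complex.exp_eq_one_iff]
    rintro ⟨n, hn⟩
    have : (a * q / v : ℂ) = n := by
      have := Complex.two_pi_I_ne_zero
      apply mul_left_cancel₀ this
      rw [hn]
      ring
    rw [div_eq_iff hv'] at this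
    exact h ⟨n, by rw [mul_comm (v : ℤ)]; exact_mod_cast this⟩
  have hzK : z ^ K = 1 := by
    obtain ⟨s, rfl⟩ := hK
    rw [hz, ← Complex.exp_nat_mul, Complex.exp_eq_one_iff]
    refine ⟨a * q * s, ?_⟩
    push_cast
    field_simp
  rw [Finset.sum_congr rfl (g := fun l ↦ (starRingEnd ℂ) (χ r) *
    Complex.exp (2 * π * Complex.I * (a * r / v)) * z ^ l), ← Finset.mul_sum, geom_sum_eq hz₁, hzK,
    sub_self, zero_div, mul_zero]
  intro l _
  rw [hz, ← Complex.exp_nat_mul, mul_assoc ((starRingEnd ℂ) (χ r)), ← Complex.exp_add]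
  congr 2
  · simp
  · push_cast
    ring

/-- The Fourier expansion in `m` of the value at the cusp `u / v`. -/
lemma hasSum_sum_bernoulliFun {q₁ q₂ : ℕ} (u v : ℕ) (χ₁ : DirichletCharacter ℂ q₁)
    (χ₂ : DirichletCharacter ℂ q₂) (R : ℕ) :
    HasSum (fun m : ℤ ↦ 1 / (m : ℂ) ^ 2 * (conjGaussSum χ₁ m *
        ∑ r ∈ Finset.range R, (starRingEnd ℂ) (χ₂ r) *
          Complex.exp (2 * π * Complex.I * ((m * u : ℤ) * r / v))))
      (2 * (π : ℂ) ^ 2 * ∑ r ∈ Finset.range R, ∑ n ∈ Finset.range q₁,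
        (starRingEnd ℂ) (χ₂ r) * (starRingEnd ℂ) (χ₁ n) *
          (bernoulliFun 2 (Int.fract ((n : ℝ) / q₁ + u * r / v)) : ℝ)) := by
  have h := hasSum_sum (s := Finset.range R) fun r _ ↦ hasSum_sum (s := Finset.range q₁) fun n _ ↦
    (hasSum_bernoulliFun_two_fract ((n : ℝ) / q₁ + u * r / v)).mul_left
      ((starRingEnd ℂ) (χ₂ r) * (starRingEnd ℂ) (χ₁ n))
  convert! h using 1
  · funext m
    rw [conjGaussSum, Finset.sum_mul_sum, Finset.sum_comm, Finset.mul_sum]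
    refine Finset.sum_congr rfl fun r _ ↦ ?_
    rw [Finset.mul_sum]
    refine Finset.sum_congr rfl fun n _ ↦ ?_
    push_cast
    rw [show 2 * (π : ℂ) * Complex.I * (m * (n / q₁ + u * r / v)) =
      2 * π * Complex.I * (m * n / q₁) + 2 * π * Complex.I * (m * u * r / v) by ring,
      Complex.exp_add]
    ring
  · simp only [Finset.mul_sum]
    refine Finset.sum_congr rfl fun r _ ↦ Finset.sum_congr rfl fun n _ ↦ ?_
    ring

lemma changeLevel_mul_changeLevel_apply {q₁ q₂ : ℕ} [NeZero q₁] [NeZero q₂]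
    (χ₁ : DirichletCharacter ℂ q₁) (χ₂ : DirichletCharacter ℂ q₂) (n : ℤ) :
    (DirichletCharacter.changeLevel (dvd_mul_right q₁ q₂) χ₁ *
      DirichletCharacter.changeLevel (dvd_mul_left q₂ q₁) χ₂) n = χ₁ n * χ₂ n := by
  rw [MulChar.mul_apply]
  by_cases h : IsCoprime n (q₁ * q₂ : ℕ)
  · rw [DirichletCharacter.changeLevel_eq_cast_of_dvd' _ _ h,
      DirichletCharacter.changeLevel_eq_cast_of_dvd' _ _ h]
  · rw [(DirichletCharacter.apply_eq_zero_iff _ n).2 h, zero_mul, eq_comm, mul_eq_zero,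
      DirichletCharacter.apply_eq_zero_iff, DirichletCharacter.apply_eq_zero_iff]
    by_contra! h'
    exact h (by push_cast; exact h'.1.mul_right h'.2)

lemma exists_hasSum_nat_mul_ne_zero {q₁ q₂ : ℕ} [NeZero q₁] [NeZero q₂]
    (χ₁ : DirichletCharacter ℂ q₁) (χ₂ : DirichletCharacter ℂ q₂) :
    ∃ L : ℂ, L ≠ 0 ∧
      HasSum (fun n : ℕ ↦ 1 / ((n : ℤ) : ℂ) ^ 2 * (χ₁ (n : ℤ) * χ₂ (n : ℤ))) L := by
  obtain ⟨ψ, hψ⟩ : ∃ ψ : DirichletCharacter ℂ (q₁ * q₂), ∀ n : ℤ, ψ n = χ₁ n * χ₂ n :=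
    ⟨_, changeLevel_mul_changeLevel_apply χ₁ χ₂⟩
  have hs : 1 < (2 : ℂ).re := by norm_num
  refine ⟨_, DirichletCharacter.LSeries_ne_zero_of_one_lt_re ψ hs, ?_⟩
  have hL := (DirichletCharacter.LSeriesSummable_of_one_lt_re ψ hs).LSeriesHasSum
  have hterm (n : ℕ) : LSeries.term (fun n : ℕ ↦ ψ n) 2 n =
      1 / ((n : ℤ) : ℂ) ^ 2 * (χ₁ (n : ℤ) * χ₂ (n : ℤ)) := by
    rw [LSeries.term_def]
    split_ifs with hn
    · simp [hn]
    · rw [← hψ, Complex.cpow_ofNat, Int.cast_natCast, Int.cast_natCast]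
      ring
  rwa [LSeriesHasSum, funext hterm] at hL

/-- For an even product, the two-sided series of `χ₁ χ₂` at `2` is twice a nonzero L-value. -/
lemma exists_hasSum_mul_ne_zero {q₁ q₂ : ℕ} [NeZero q₁] [NeZero q₂]
    (χ₁ : DirichletCharacter ℂ q₁) (χ₂ : DirichletCharacter ℂ q₂)
    (hpar : χ₁ (-1) * χ₂ (-1) = 1) :
    ∃ L : ℂ, L ≠ 0 ∧ HasSum (fun t : ℤ ↦ 1 / (t : ℂ) ^ 2 * (χ₁ t * χ₂ t)) L := by
  obtain ⟨L, h_ne, h₁⟩ := exists_hasSum_nat_mul_ne_zero χ₁ χ₂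
  obtain ⟨f, hf⟩ : ∃ f : ℤ → ℂ, ∀ t : ℤ, f t = 1 / (t : ℂ) ^ 2 * (χ₁ t * χ₂ t) :=
    ⟨_, fun _ ↦ rfl⟩
  have hneg (t : ℤ) : f (-t) = f t := by
    rw [hf, hf, Int.cast_neg, Int.cast_neg, Int.cast_neg, neg_sq]
    rw [neg_eq_neg_one_mul (t : ZMod q₁), neg_eq_neg_one_mul (t : ZMod q₂), map_mul, map_mul]
    linear_combination (1 / (t : ℂ) ^ 2 * (χ₁ t * χ₂ t)) * hpar
  have hzero : f 0 = 0 := by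
    rw [hf, Int.cast_zero, zero_pow two_ne_zero, div_zero, zero_mul]
  have h₁' : HasSum (fun n : ℕ ↦ f n) L := by
    rw [funext fun n : ℕ ↦ hf n]
    exact h₁
  have h₂ : HasSum (fun n : ℕ ↦ f (-(n : ℤ))) L := by
    rw [funext fun n : ℕ ↦ hneg n]
    exact h₁'
  have h₃ := h₁'.of_nat_of_neg h₂
  rw [hzero, sub_zero, funext hf] at h₃
  exact ⟨L + L, by simpa using h_ne, h₃⟩

/-- At cusps of denominator `q₂ v'`, the newform Dedekind sum separates the two characters. -/
lemma exists_newformDedekindSum_eq_mul {q₁ q₂ : ℕ} (hq₁ : 1 < q₁) (hq₂ : 1 < q₂)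
    {χ₁ : DirichletCharacter ℂ q₁} {χ₂ : DirichletCharacter ℂ q₂}
    (hχ₁ : χ₁.IsPrimitive) (hχ₂ : χ₂.IsPrimitive) (hpar : χ₁ (-1) * χ₂ (-1) = 1) :
    ∃ κ : ℂ, κ ≠ 0 ∧ ∀ u v : ℕ, 0 < v → u.Coprime (q₂ * v) →
      newformDedekindSum χ₁ χ₂ (1 + ((q₁ * q₂ : ℕ) : ℤ) ^ 2 * u * (q₂ * v : ℕ))
        (((q₂ * v : ℕ) * (q₁ * q₂ : ℕ) : ℤ) ^ 2) = κ * (χ₁ v * χ₂ u) := by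
  have : NeZero q₁ := ⟨by lia⟩
  have : NeZero q₂ := ⟨by lia⟩
  obtain ⟨L, hL, hsum⟩ := exists_hasSum_mul_ne_zero χ₁ χ₂ hpar
  have hπ : (π : ℂ) ≠ 0 := by exact_mod_cast Real.pi_ne_zero
  have hq₁' : (q₁ : ℂ) ≠ 0 := NeZero.ne _
  have hq₂' : (q₂ : ℂ) ≠ 0 := NeZero.ne _
  refine ⟨(q₁ : ℂ) ^ 2 * q₂ ^ 3 * conjGaussSum χ₁ 1 * conjGaussSum χ₂ 1 * L / (4 * π ^ 2), ?_, ?_⟩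
  · have := conjGaussSum_one_ne_zero hχ₁
    have := conjGaussSum_one_ne_zero hχ₂
    simp_all
  intro u v hv huv
  have hv' : (v : ℂ) ≠ 0 := by exact_mod_cast hv.ne'
  have hvZ : (v : ℤ) ≠ 0 := by exact_mod_cast hv.ne'
  have hw : 0 < q₂ * v := by positivity
  rw [newformDedekindSum_parabolic hq₁ hq₂ hw χ₂ hχ₁]
  have key := hasSum_sum_bernoulliFun u (q₂ * v) χ₁ χ₂ (q₂ * v * (q₁ * q₂))
  have hinj : Function.Injective fun t : ℤ ↦ (v : ℤ) * t := mul_right_injective₀ hvZ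
  rw [← hinj.hasSum_iff] at key
  · have hterm (t : ℤ) : 1 / (((v : ℤ) * t : ℤ) : ℂ) ^ 2 * (conjGaussSum χ₁ ((v : ℤ) * t) *
        ∑ r ∈ Finset.range (q₂ * v * (q₁ * q₂)), (starRingEnd ℂ) (χ₂ r) *
          Complex.exp (2 * π * Complex.I * (((v : ℤ) * t * u : ℤ) * r / (q₂ * v : ℕ)))) =
        ((q₂ * v * q₁ : ℂ) * conjGaussSum χ₁ 1 * conjGaussSum χ₂ 1 * (χ₁ v * χ₂ u) / v ^ 2) *
          (1 / (t : ℂ) ^ 2 * (χ₁ t * χ₂ t)) := by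
      rw [show q₂ * v * (q₁ * q₂) = q₂ * (q₂ * v * q₁) by ring,
        sum_range_mul_conj_mul_exp_of_mul_eq (t := t * u) (by lia) hw χ₂
          (by push_cast; ring), conjGaussSum_eq_mul hχ₁, conjGaussSum_eq_mul hχ₂ (t * u)]
      push_cast
      rw [map_mul, map_mul, mul_pow]
      field_simp
    rw [Function.comp_def, funext hterm] at key
    have h := key.unique (hsum.mul_left _)
    rw [mul_comm, ← eq_div_iff (by simp [hπ])] at h
    rw [h]
    push_cast
    field_simp
    ring
  · intro m hm
    rw [show q₂ * v * (q₁ * q₂) = q₂ * (q₂ * v * q₁) by ring,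
      sum_range_mul_conj_mul_exp_of_not_dvd hw (Dvd.intro _ rfl), mul_zero, mul_zero]
    intro hdvd
    apply hm
    have h₁ : ((q₂ * v : ℕ) : ℤ) ∣ m * q₂ := by
      refine (Nat.isCoprime_iff_coprime.2 huv.symm).dvd_of_dvd_mul_left (y := (u : ℤ)) ?_
      rwa [show (u : ℤ) * (m * q₂) = m * u * q₂ by ring]
    rw [mul_comm m] at h₁
    push_cast at h₁
    obtain ⟨t, rfl⟩ := Int.dvd_of_mul_dvd_mul_left (by exact_mod_cast (NeZero.ne q₂)) h₁
    exact ⟨t, rfl⟩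

/-- The newform Dedekind sum vanishes at cusps whose denominator is a multiple of a divisor
of the level other than `q₂`, up to a factor coprime to the level. -/
lemma newformDedekindSum_eq_zero {q₁ q₂ Q u v : ℕ} (hq₁ : 1 < q₁) (hq₂ : 1 < q₂)
    {χ₁ : DirichletCharacter ℂ q₁} {χ₂ : DirichletCharacter ℂ q₂}
    (hχ₁ : χ₁.IsPrimitive) (hχ₂ : χ₂.IsPrimitive) (hQ : Q ∣ q₁ * q₂) (h_ne : q₂ ≠ Q)
    (hv : 0 < v) (hvN : v.Coprime (q₁ * q₂)) (huv : u.Coprime (Q * v)) :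
    newformDedekindSum χ₁ χ₂ (1 + ((q₁ * q₂ : ℕ) : ℤ) ^ 2 * u * (Q * v : ℕ))
      (((Q * v : ℕ) * (q₁ * q₂ : ℕ) : ℤ) ^ 2) = 0 := by
  have : NeZero q₁ := ⟨by lia⟩
  have : NeZero q₂ := ⟨by lia⟩
  have hQ₀ : 0 < Q := Nat.pos_of_dvd_of_pos hQ (by positivity)
  have hw : 0 < Q * v := by positivity
  rw [newformDedekindSum_parabolic hq₁ hq₂ hw χ₂ hχ₁]
  have key := hasSum_sum_bernoulliFun u (Q * v) χ₁ χ₂ (Q * v * (q₁ * q₂))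
  have hterm (m : ℤ) : 1 / (m : ℂ) ^ 2 * (conjGaussSum χ₁ m *
      ∑ r ∈ Finset.range (Q * v * (q₁ * q₂)), (starRingEnd ℂ) (χ₂ r) *
        Complex.exp (2 * π * Complex.I * ((m * u : ℤ) * r / (Q * v : ℕ)))) = 0 := by
    rw [show Q * v * (q₁ * q₂) = q₂ * (Q * v * q₁) by ring]
    by_cases hdvd : ((Q * v : ℕ) : ℤ) ∣ m * u * q₂
    · have h₁ : ((Q * v : ℕ) : ℤ) ∣ m * q₂ := by
        refine (Nat.isCoprime_iff_coprime.2 huv.symm).dvd_of_dvd_mul_left (y := (u : ℤ)) ?_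
        rwa [show (u : ℤ) * (m * q₂) = m * u * q₂ by ring]
      obtain ⟨t, ht⟩ := h₁
      rw [sum_range_mul_conj_mul_exp_of_mul_eq (t := t * u) (by lia) hw χ₂
          (by linear_combination (u : ℤ) * ht), conjGaussSum_eq_mul hχ₁,
          conjGaussSum_eq_mul hχ₂ (t * u)]
      suffices χ₁ m = 0 ∨ χ₂ (t * u : ℤ) = 0 by
        rcases this with h | h <;> rw [h] <;> ring
      rw [DirichletCharacter.apply_eq_zero_iff, DirichletCharacter.apply_eq_zero_iff]
      by_contra! h
      have hq₂v : IsCoprime (q₂ : ℤ) v := Nat.isCoprime_iff_coprime.2 hvN.symm.coprime_mul_left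
      have hdvd' : (q₂ : ℤ) ∣ Q := by
        refine hq₂v.dvd_of_dvd_mul_right (h.2.of_mul_left_left.symm.dvd_of_dvd_mul_right ?_)
        rw [← Nat.cast_mul, ← ht]
        exact dvd_mul_left _ _
      obtain ⟨e, rfl⟩ := Int.natCast_dvd_natCast.1 hdvd'
      have he : e ∣ q₁ := by
        rw [mul_comm q₁] at hQ
        exact Nat.dvd_of_mul_dvd_mul_left (by lia) hQ
      have hm : m = e * v * t := by
        have : (q₂ : ℤ) ≠ 0 := by exact_mod_cast NeZero.ne q₂
        apply mul_right_cancel₀ this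
        rw [ht]
        push_cast
        ring
      have h_unit : IsUnit (e : ℤ) := h.1.isUnit_of_dvd'
        (by rw [hm, mul_assoc]; exact dvd_mul_right _ _) (Int.natCast_dvd_natCast.2 he)
      rw [Int.ofNat_isUnit, Nat.isUnit_iff] at h_unit
      exact h_ne (by rw [h_unit, mul_one])
    · rw [sum_range_mul_conj_mul_exp_of_not_dvd hw (Dvd.intro _ rfl) χ₂ hdvd, mul_zero, mul_zero]
  rw [funext hterm] at key
  have h := key.unique hasSum_zero
  have hπ : (π : ℂ) ≠ 0 := by exact_mod_cast Real.pi_ne_zero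
  rw [mul_eq_zero, or_iff_right (by simp [hπ])] at h
  rw [h, mul_zero]

lemma DirichletCharacter.IsPrimitive.sigma_ext {N q q' : ℕ} [NeZero N] {χ : DirichletCharacter ℂ q}
    {ψ : DirichletCharacter ℂ q'} (hχ : χ.IsPrimitive) (hψ : ψ.IsPrimitive) (hq : q ∣ N)
    (hq' : q' ∣ N)
    (h : DirichletCharacter.changeLevel hq χ = DirichletCharacter.changeLevel hq' ψ) :
    (⟨q, χ⟩ : Σ q, DirichletCharacter ℂ q) = ⟨q', ψ⟩ := by
  have h₁ := congrArg DirichletCharacter.conductor h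
  rw [DirichletCharacter.conductor_changeLevel, DirichletCharacter.conductor_changeLevel,
    show χ.conductor = q from hχ,
    show ψ.conductor = q' from hψ] at h₁
  subst h₁
  rw [DirichletCharacter.changeLevel_injective hq h]

/-- The character `(x, y) ↦ α x * β y` of the product of two copies of `(ZMod N)ˣ`. -/
noncomputable def unitsCoprodHom {N : ℕ} (α β : DirichletCharacter ℂ N) :
    (ZMod N)ˣ × (ZMod N)ˣ →* ℂ :=
  (α.toMonoidHom.comp (Units.coeHom _)).coprod (β.toMonoidHom.comp (Units.coeHom _))

lemma unitsCoprodHom_apply {N : ℕ} (α β : DirichletCharacter ℂ N) (x : (ZMod N)ˣ × (ZMod N)ˣ) :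
    unitsCoprodHom α β x = α x.1 * β x.2 := rfl

lemma unitsCoprodHom_inj {N : ℕ} {α β α' β' : DirichletCharacter ℂ N}
    (h : unitsCoprodHom α β = unitsCoprodHom α' β') : α = α' ∧ β = β' := by
  constructor
  · ext x
    simpa [unitsCoprodHom_apply] using DFunLike.congr_fun h (x, 1)
  · ext x
    simpa [unitsCoprodHom_apply] using DFunLike.congr_fun h (1, x)

lemma exists_natCast_eq_unit_and_coprime {N v : ℕ} [NeZero N] (hv : 0 < v) (y : (ZMod N)ˣ) :
    ∃ u : ℕ, (u : ZMod N) = y ∧ u.Coprime (N * v) := by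
  have : NeZero (N * v) := ⟨mul_ne_zero (NeZero.ne N) hv.ne'⟩
  obtain ⟨z, rfl⟩ := ZMod.unitsMap_surjective (dvd_mul_right N v) y
  refine ⟨(z : ZMod (N * v)).val, ?_, ZMod.val_coe_unit_coprime z⟩
  rw [ZMod.natCast_val, ZMod.unitsMap_val]

lemma changeLevel_natCast {N q : ℕ} (hq : q ∣ N) (χ : DirichletCharacter ℂ q) {a : ℕ}
    (ha : a.Coprime N) : DirichletCharacter.changeLevel hq χ a = χ a := by
  exact_mod_cast DirichletCharacter.changeLevel_eq_cast_of_dvd' χ hq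
    (Nat.isCoprime_iff_coprime.2 ha)

lemma exists_mem_Gamma1_SGamma_eq (N u w : ℕ) (hN : 0 < N) (hw : 0 < w) :
    ∃ γ ∈ CongruenceSubgroup.Gamma1 N, ∀ (q₁ q₂ : ℕ) (χ₁ : DirichletCharacter ℂ q₁)
      (χ₂ : DirichletCharacter ℂ q₂), SGamma χ₁ χ₂ γ =
        newformDedekindSum χ₁ χ₂ (1 + (N : ℤ) ^ 2 * u * w) ((w * N : ℤ) ^ 2) := by
  obtain ⟨γ, hγ⟩ : ∃ γ : Matrix.SpecialLinearGroup (Fin 2) ℤ,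
      (γ : Matrix (Fin 2) (Fin 2) ℤ) = !![1 + (N : ℤ) ^ 2 * u * w, -((N : ℤ) ^ 2 * u ^ 2);
        (w * N : ℤ) ^ 2, 1 - (N : ℤ) ^ 2 * u * w] := by
    refine ⟨⟨_, ?_⟩, rfl⟩
    rw [Matrix.det_fin_two_of]
    ring
  refine ⟨γ, ?_, fun q₁ q₂ χ₁ χ₂ ↦ ?_⟩
  · rw [CongruenceSubgroup.Gamma1_mem, hγ]
    simp
  · have : (0 : ℤ) < (w * N) ^ 2 := by positivity
    simp [SGamma, hγ, this]

/-- The newform Dedekind sums are linearly independent in `Hom(Γ₁(N), ℂ)`: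
if a finite collection of newform Dedekind sums attached to pairwise distinct ordered pairs
of primitive characters `(χ₁⁽ⁱ⁾, χ₂⁽ⁱ⁾)` (with `q₁⁽ⁱ⁾ q₂⁽ⁱ⁾ = N`) satisfies a vanishing
linear relation on `Γ₁(N)`, then all coefficients vanish. -/
theorem newform_dedekind_sums_linearly_independent (N : ℕ) (hN : 1 ≤ N) (r : ℕ)
    (q₁ q₂ : Fin r → ℕ)
    (χ₁ : ∀ i, DirichletCharacter ℂ (q₁ i)) (χ₂ : ∀ i, DirichletCharacter ℂ (q₂ i))
    (hq₁ : ∀ i, 1 < q₁ i) (hq₂ : ∀ i, 1 < q₂ i) (hlevel : ∀ i, q₁ i * q₂ i = N)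
    (hχ₁ : ∀ i, DirichletCharacter.IsPrimitive (χ₁ i))
    (hχ₂ : ∀ i, DirichletCharacter.IsPrimitive (χ₂ i))
    (hpar : ∀ i, χ₁ i (-1) * χ₂ i (-1) = 1)
    (hdistinct : Function.Injective fun i =>
      ((⟨q₁ i, χ₁ i⟩ : Σ q, DirichletCharacter ℂ q), (⟨q₂ i, χ₂ i⟩ : Σ q, DirichletCharacter ℂ q)))
    (c : Fin r → ℂ)
    (hrel : ∀ γ ∈ CongruenceSubgroup.Gamma1 N, ∑ i, c i * SGamma (χ₁ i) (χ₂ i) γ = 0) :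
    ∀ i, c i = 0 := by
  have hN₀ : NeZero N := ⟨by lia⟩
  intro i₀
  have hd₁ (i) : q₁ i ∣ N := hlevel i ▸ dvd_mul_right _ _
  have hd₂ (i) : q₂ i ∣ N := hlevel i ▸ dvd_mul_left _ _
  choose κ hκ hS using fun i ↦
    exists_newformDedekindSum_eq_mul (hq₁ i) (hq₂ i) (hχ₁ i) (hχ₂ i) (hpar i)
  let f (i : Fin r) := unitsCoprodHom (DirichletCharacter.changeLevel (hd₁ i) (χ₁ i))
    (DirichletCharacter.changeLevel (hd₂ i) (χ₂ i))
  have hf : Function.Injective f := fun i j hij ↦ by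
    obtain ⟨h₁, h₂⟩ := unitsCoprodHom_inj hij
    exact hdistinct (Prod.ext ((hχ₁ i).sigma_ext (hχ₁ j) _ _ h₁)
      ((hχ₂ i).sigma_ext (hχ₂ j) _ _ h₂))
  let d (i : Fin r) : ℂ := if q₂ i = q₂ i₀ then c i * κ i else 0
  have hsum : ∑ i, d i • (f i : (ZMod N)ˣ × (ZMod N)ˣ → ℂ) = 0 := by
    funext ⟨x, y⟩
    obtain ⟨v, hv₀, hvx, hvN⟩ : ∃ v : ℕ, 0 < v ∧ (v : ZMod N) = x ∧ v.Coprime N := by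
      have h_coprime := ZMod.val_coe_unit_coprime x
      refine ⟨(x : ZMod N).val, Nat.pos_of_ne_zero fun h ↦ ?_, by simp, h_coprime⟩
      rw [h, Nat.coprime_zero_left] at h_coprime
      have := Nat.le_of_dvd (by lia) (hd₁ i₀)
      have := hq₁ i₀
      lia
    obtain ⟨u, huy, huN⟩ := exists_natCast_eq_unit_and_coprime hv₀ y
    have hw : 0 < q₂ i₀ * v := Nat.mul_pos (by have := hq₂ i₀; lia) hv₀
    obtain ⟨γ, hγ, hSγ⟩ := exists_mem_Gamma1_SGamma_eq N u (q₂ i₀ * v) (by lia) hw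
    have huv : u.Coprime (q₂ i₀ * v) :=
      huN.coprime_dvd_right (Nat.mul_dvd_mul_right (hd₂ i₀) v)
    rw [Finset.sum_apply, Pi.zero_apply, ← hrel γ hγ]
    refine Finset.sum_congr rfl fun i _ ↦ ?_
    rw [hSγ, Pi.smul_apply, smul_eq_mul, unitsCoprodHom_apply, ← hvx, ← huy,
      changeLevel_natCast _ _ hvN, changeLevel_natCast _ _ huN.coprime_mul_right_right]
    by_cases h : q₂ i = q₂ i₀
    · rw [← h] at huv
      have := hS i u v hv₀ huv
      rw [hlevel i] at this
      simp only [d, if_pos h]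
      rw [← h, this, mul_assoc]
    · have := newformDedekindSum_eq_zero (hq₁ i) (hq₂ i) (hχ₁ i) (hχ₂ i)
        (hlevel i ▸ hd₂ i₀) h hv₀ (hlevel i ▸ hvN) huv
      rw [hlevel i] at this
      simp only [d, if_neg h]
      rw [this, zero_mul, mul_zero]
  have hli := (linearIndependent_monoidHom ((ZMod N)ˣ × (ZMod N)ˣ) ℂ).comp f hf
  have h₀ := Fintype.linearIndependent_iff.1 hli d hsum i₀
  simpa [d, hκ i₀] using h₀
end

section
/- The newform Dedekind sum is a crossed homomorphism on Γ₀(q₁q₂): for all γ₁, γ₂ ∈ Γ₀(q₁q₂), S_{χ₁,χ₂}(γ₁γ₂) = S_{χ₁,χ₂}(γ₁) + ψ(γ₁)·S_{χ₁,χ₂}(γ₂), where ψ(γ₁) = ψ(d₁) with d₁ the lower-right entry of γ₁. In particular, the restriction of S_{χ₁,χ₂} to Γ₁(q₁q₂) is a group homomorphism into (ℂ, +). -/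
open scoped BigOperators

theorem sawtooth_eq_fract (x : ℝ) :
    sawtooth x = Int.fract x - 1 / 2 + if Int.fract x = 0 then 1 / 2 else 0 := by
  have h : (∃ n : ℤ, x = (n : ℝ)) ↔ Int.fract x = 0 := by
    rw [Int.fract_eq_zero_iff]
    exact ⟨fun ⟨n, hn⟩ => ⟨n, hn.symm⟩, fun ⟨n, hn⟩ => ⟨n, hn.symm⟩⟩
  unfold sawtooth
  by_cases hx : Int.fract x = 0
  · rw [if_pos (h.2 hx), if_pos hx, hx]; ring
  · rw [if_neg (fun h' => hx (h.1 h')), if_neg hx, Int.fract]; ring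

theorem sawtooth_add_int (x : ℝ) (m : ℤ) : sawtooth (x + m) = sawtooth x := by
  simp only [sawtooth_eq_fract, Int.fract_add_intCast]

theorem sawtooth_neg (x : ℝ) : sawtooth (-x) = -sawtooth x := by
  simp only [sawtooth_eq_fract]
  by_cases hx : Int.fract x = 0
  · rw [if_pos hx, if_pos (Int.fract_neg_eq_zero.2 hx), hx, Int.fract_neg_eq_zero.2 hx]; ring
  · rw [if_neg hx, if_neg (mt Int.fract_neg_eq_zero.1 hx), Int.fract_neg hx]; ring

theorem sawtooth_sum_range (q : ℕ) (hq : 0 < q) (y : ℝ) :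
    ∑ k ∈ Finset.range q, sawtooth ((y + k) / q) = sawtooth y := by
  have hq' : (0 : ℝ) < q := by exact_mod_cast hq
  have hper : Function.Periodic
      (fun y : ℝ => ∑ k ∈ Finset.range q, sawtooth ((y + k) / q)) 1 := by
    intro y
    have h1 := Finset.sum_range_succ (fun k : ℕ => sawtooth ((y + k) / q)) q
    rw [Finset.sum_range_succ'] at h1
    have h2 : sawtooth ((y + (q : ℕ)) / q) = sawtooth ((y + (0 : ℕ)) / q) := by
      rw [← sawtooth_add_int ((y + (0 : ℕ)) / q) 1]
      congr 1
      push_cast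
      field_simp
      ring
    rw [h2] at h1
    have h3 := add_right_cancel h1
    refine Eq.trans ?_ h3
    refine Finset.sum_congr rfl fun k _ => ?_
    congr 2
    push_cast
    ring
  have hfl : ∑ k ∈ Finset.range q, sawtooth ((y + k) / q) =
      ∑ k ∈ Finset.range q, sawtooth ((Int.fract y + k) / q) := by
    have := hper.sub_int_mul_eq ⌊y⌋ (x := y)
    simp only [mul_one] at this
    exact this.symm
  have hterm : ∀ k ∈ Finset.range q, sawtooth ((Int.fract y + k) / q) =
      (Int.fract y - q / 2) / q + (k : ℝ) / q +
        if k = 0 then (if Int.fract y = 0 then 1 / 2 else 0) else 0 := by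
    intro k hk
    have hk' : (k : ℝ) + 1 ≤ q := by exact_mod_cast Finset.mem_range.1 hk
    have h0 := Int.fract_nonneg y
    have h1 := Int.fract_lt_one y
    have hk0 : (0 : ℝ) ≤ k := k.cast_nonneg
    have hfr : Int.fract ((Int.fract y + k) / q) = (Int.fract y + k) / q := by
      rw [Int.fract_eq_self]
      exact ⟨by positivity, by rw [div_lt_one hq']; linarith⟩
    rw [sawtooth_eq_fract, hfr]
    have hz : (Int.fract y + k) / q = 0 ↔ k = 0 ∧ Int.fract y = 0 := by
      rw [div_eq_zero_iff]
      constructor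
      · rintro (h | h)
        · exact ⟨by exact_mod_cast (by linarith : (k : ℝ) = 0), by linarith⟩
        · exact absurd h hq'.ne'
      · rintro ⟨rfl, h⟩
        left; simp [h]
    simp only [hz, ite_and]
    congr 1
    field_simp
    ring
  rw [hfl, Finset.sum_congr rfl hterm, Finset.sum_add_distrib, Finset.sum_add_distrib,
    ← Finset.sum_div _ (fun k : ℕ => (k : ℝ)), Finset.sum_ite_eq' (Finset.range q) 0,
    if_pos (Finset.mem_range.2 hq), sawtooth_eq_fract]
  have hg : (∑ k ∈ Finset.range q, (k : ℝ)) = q * (q - 1) / 2 := by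
    rw [eq_div_iff two_ne_zero]
    have h := Finset.sum_range_id_mul_two q
    have h' : ((∑ k ∈ Finset.range q, k : ℕ) : ℝ) * 2 = q * ((q - 1 : ℕ) : ℝ) := by
      exact_mod_cast h
    rw [Nat.cast_sub hq] at h'
    push_cast at h'
    exact h'
  rw [hg, Finset.sum_const, Finset.card_range, nsmul_eq_mul]
  congr 1
  field_simp
  ring

/-- The distribution relation for the sawtooth function, for a divisor of either sign. -/
theorem sawtooth_sum_range_natAbs (q : ℤ) (hq : q ≠ 0) (y : ℝ) :
    ∑ k ∈ Finset.range q.natAbs, sawtooth ((y + k) / q) = q.sign * sawtooth y := by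
  have habs := Int.natAbs_pos.2 hq
  rcases lt_or_gt_of_ne hq with h | h
  · have hc : (q : ℝ) = -(q.natAbs : ℝ) := by
      have : q = -(q.natAbs : ℤ) := by omega
      exact_mod_cast this
    rw [Int.sign_eq_neg_one_of_neg h, ← sawtooth_sum_range _ habs y]
    simp only [hc, div_neg, sawtooth_neg, Finset.sum_neg_distrib]
    push_cast
    ring
  · have hc : (q : ℝ) = (q.natAbs : ℝ) := by
      rw [Nat.cast_natAbs, abs_of_pos h]
    rw [Int.sign_eq_one_of_pos h, ← sawtooth_sum_range _ habs y, hc]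
    push_cast
    ring

theorem sawtooth_div_eq_of_dvd {k m m' : ℤ} (h : k ∣ m - m') :
    sawtooth ((m : ℝ) / k) = sawtooth ((m' : ℝ) / k) := by
  obtain ⟨t, ht⟩ := h
  rcases eq_or_ne k 0 with rfl | hk
  · simp
  · have hk' : (k : ℝ) ≠ 0 := by exact_mod_cast hk
    have hm : (m : ℝ) = m' + k * t := by
      have : m = m' + k * t := by linarith
      exact_mod_cast this
    rw [← sawtooth_add_int ((m' : ℝ) / k) t, hm]
    congr 1
    field_simp

/-- The periodic second Bernoulli function. -/
noncomputable def periodicBernoulliTwo (x : ℝ) : ℝ := Int.fract x ^ 2 - Int.fract x + 1 / 6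

theorem sawtooth_mul_add_of_add_eq_zero {x y z : ℝ} (h : x + y + z = 0)
    (hne : ¬(Int.fract x = 0 ∧ Int.fract y = 0)) :
    sawtooth x * sawtooth y + sawtooth y * sawtooth z + sawtooth z * sawtooth x =
      -(1 / 2) * (periodicBernoulliTwo x + periodicBernoulliTwo y + periodicBernoulliTwo z) := by
  simp only [sawtooth_eq_fract, periodicBernoulliTwo]
  have hx0 := Int.fract_nonneg x
  have hx1 := Int.fract_lt_one x
  have hy0 := Int.fract_nonneg y
  have hy1 := Int.fract_lt_one y
  have hz0 := Int.fract_nonneg z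
  have hz1 := Int.fract_lt_one z
  have hx := Int.fract_add_floor x
  have hy := Int.fract_add_floor y
  have hz := Int.fract_add_floor z
  obtain ⟨m, hm⟩ : ∃ m : ℤ, Int.fract x + Int.fract y + Int.fract z = m :=
    ⟨-(⌊x⌋ + ⌊y⌋ + ⌊z⌋), by push_cast; linarith⟩
  have hm0 : (0 : ℝ) ≤ m := by linarith
  have hm3 : (m : ℝ) < 3 := by linarith
  have hm0' : 0 ≤ m := by exact_mod_cast hm0
  have hm3' : m < 3 := by exact_mod_cast hm3
  generalize Int.fract x = a at *
  generalize Int.fract y = b at *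
  generalize Int.fract z = c at *
  have hm' : m ≠ 0 := by
    rintro rfl
    push_cast at hm
    exact hne ⟨by linarith, by linarith⟩
  obtain rfl | rfl : m = 1 ∨ m = 2 := by omega
  all_goals
    push_cast at hm
    obtain rfl := eq_sub_of_add_eq' hm
    split_ifs
    all_goals first
      | exact absurd ⟨‹a = 0›, ‹b = 0›⟩ hne
      | (exfalso; linarith)
      | linear_combination (-1 / 2) * ‹a = 0›
      | linear_combination (-1 / 2) * ‹b = 0›
      | linear_combination (-1 / 2) * ‹_ - (a + b) = (0 : ℝ)›
      | ring

/-- A function on `ℤ²` that only depends on its arguments modulo `N`. -/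
def IsModPeriodic (N : ℕ) (g : ℤ × ℤ → ℂ) : Prop :=
  ∀ x y : ℤ × ℤ, (N : ℤ) ∣ x.1 - y.1 → (N : ℤ) ∣ x.2 - y.2 → g x = g y

/-- The sum of a function over the box of representatives of `ℤ²` modulo `N`. -/
noncomputable def periodSum (N : ℕ) [NeZero N] (g : ℤ × ℤ → ℂ) : ℂ :=
  ∑ x : ZMod N × ZMod N, g (x.1.cast, x.2.cast)

theorem dvd_cast_intCast_sub {N : ℕ} (m : ℤ) : (N : ℤ) ∣ ((m : ZMod N).cast : ℤ) - m := by
  rw [← Int.modEq_iff_dvd, ← ZMod.intCast_eq_intCast_iff]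
  simp

theorem periodSum_comp {N : ℕ} [NeZero N] {g : ℤ × ℤ → ℂ} (hg : IsModPeriodic N g)
    (φ : ℤ × ℤ → ℤ × ℤ) (e : ZMod N × ZMod N ≃ ZMod N × ZMod N)
    (he : ∀ x : ℤ × ℤ, e ((x.1 : ZMod N), (x.2 : ZMod N)) =
      (((φ x).1 : ZMod N), ((φ x).2 : ZMod N))) :
    periodSum N (fun x => g (φ x)) = periodSum N g := by
  unfold periodSum
  rw [← Equiv.sum_comp e (fun x => g (x.1.cast, x.2.cast))]
  refine Finset.sum_congr rfl fun x _ => ?_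
  have h := he (x.1.cast, x.2.cast)
  simp only [ZMod.intCast_zmod_cast] at h
  rw [h]
  refine (hg _ _ ?_ ?_).symm <;> exact dvd_cast_intCast_sub _

theorem periodSum_add_right {N : ℕ} [NeZero N] {g : ℤ × ℤ → ℂ} (hg : IsModPeriodic N g)
    (t : ℤ × ℤ) : periodSum N (fun x => g (x + t)) = periodSum N g :=
  periodSum_comp hg (fun x => x + t) (Equiv.addRight ((t.1 : ZMod N), (t.2 : ZMod N)))
    (fun x => by simp)

theorem periodSum_sum {ι : Type*} (N : ℕ) [NeZero N] (s : Finset ι) (g : ι → ℤ × ℤ → ℂ) :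
    periodSum N (fun x => ∑ i ∈ s, g i x) = ∑ i ∈ s, periodSum N (g i) :=
  Finset.sum_comm

theorem periodSum_const_mul (N : ℕ) [NeZero N] (c : ℂ) (g : ℤ × ℤ → ℂ) :
    periodSum N (fun x => c * g x) = c * periodSum N g :=
  (Finset.mul_sum _ _ _).symm

theorem periodSum_add (N : ℕ) [NeZero N] (g h : ℤ × ℤ → ℂ) :
    periodSum N (fun x => g x + h x) = periodSum N g + periodSum N h :=
  Finset.sum_add_distrib

theorem sum_zmod_cast_eq_sum_range {N : ℕ} [NeZero N] (g : ℤ → ℂ) :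
    ∑ x : ZMod N, g x.cast = ∑ i ∈ Finset.range N, g i := by
  obtain ⟨n, rfl⟩ := Nat.exists_eq_succ_of_ne_zero (NeZero.ne N)
  rw [← Fin.sum_univ_eq_sum_range (fun i => g (i : ℤ))]
  refine Finset.sum_congr rfl fun x _ => ?_
  rw [ZMod.cast_eq_val]
  rfl

theorem sum_range_mul_of_periodic {k : ℕ} (t : ℕ) {g : ℤ → ℂ}
    (hg : Function.Periodic g (k : ℤ)) :
    ∑ i ∈ Finset.range (k * t), g i = t * ∑ i ∈ Finset.range k, g i := by
  induction t with
  | zero => simp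
  | succ t ih =>
    rw [Nat.mul_succ, Finset.sum_range_add, ih]
    have : ∀ i : ℕ, g ((k * t + i : ℕ) : ℤ) = g i := fun i => by
      have := hg.nat_mul t (i : ℤ)
      rw [← this]
      congr 1
      push_cast
      ring
    simp only [this]
    push_cast
    ring

theorem periodSum_eq_of_periodic {N k l s t : ℕ} [NeZero N] (hk : N = k * s) (hl : N = l * t)
    {g : ℤ × ℤ → ℂ} (h1 : ∀ j, Function.Periodic (fun n => g (n, j)) (k : ℤ))
    (h2 : ∀ n, Function.Periodic (fun j => g (n, j)) (l : ℤ)) :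
    periodSum N g = s * t * ∑ j ∈ Finset.range l, ∑ n ∈ Finset.range k, g (n, j) := by
  unfold periodSum
  rw [Fintype.sum_prod_type_right]
  simp only
  have e1 : ∀ j : ℤ, ∑ x : ZMod N, g (x.cast, j) = s * ∑ n ∈ Finset.range k, g (n, j) := by
    intro j
    rw [sum_zmod_cast_eq_sum_range (fun n => g (n, j)), hk]
    exact sum_range_mul_of_periodic s (h1 j)
  simp only [e1]
  rw [← Finset.mul_sum, sum_zmod_cast_eq_sum_range (fun j => ∑ n ∈ Finset.range k, g (n, j))]
  conv_lhs => rw [hl]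
  rw [sum_range_mul_of_periodic t (g := fun j => ∑ n ∈ Finset.range k, g (n, j))]
  · ring
  · intro j
    exact Finset.sum_congr rfl fun n _ => h2 n j

section DedekindKernel

variable {q₁ q₂ : ℕ} (χ₁ : DirichletCharacter ℂ q₁) (χ₂ : DirichletCharacter ℂ q₂)

/-- The determinant of two integral column vectors. -/
def crossDet (u v : ℤ × ℤ) : ℤ := u.1 * v.2 - u.2 * v.1

/-- The linear form on `ℤ²` attached to an integral column vector. -/
def columnForm (u x : ℤ × ℤ) : ℤ := u.1 * x.2 + u.2 * x.1

/-- The weight `χ̄₂(j) χ̄₁(n)` at `x = (n, j)`. -/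
noncomputable def dedekindWeight (x : ℤ × ℤ) : ℂ :=
  (starRingEnd ℂ) (χ₂ (x.2 : ZMod q₂)) * (starRingEnd ℂ) (χ₁ (x.1 : ZMod q₁))

/-- The summand of a Dedekind sum attached to two columns and two denominators. -/
noncomputable def dedekindKernel (u v : ℤ × ℤ) (r s : ℤ) (x : ℤ × ℤ) : ℂ :=
  dedekindWeight χ₁ χ₂ x * (sawtooth ((columnForm u x : ℝ) / r) : ℝ) *
    (sawtooth ((columnForm v x : ℝ) / s) : ℝ)

/-- The Dedekind symbol of two columns, summed over a full period modulo `N`. -/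
noncomputable def dedekindSymbol (N : ℕ) [NeZero N] (u v : ℤ × ℤ) : ℂ :=
  ((q₁ * crossDet u v : ℤ) : ℂ) *
    periodSum N (dedekindKernel χ₁ χ₂ u v (q₁ * crossDet u v) (q₁ * crossDet u v))

theorem dedekindWeight_congr {x y : ℤ × ℤ} (h1 : (q₁ : ℤ) ∣ x.1 - y.1)
    (h2 : (q₂ : ℤ) ∣ x.2 - y.2) : dedekindWeight χ₁ χ₂ x = dedekindWeight χ₁ χ₂ y := by
  have e1 := (ZMod.intCast_eq_intCast_iff_dvd_sub y.1 x.1 q₁).2 h1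
  have e2 := (ZMod.intCast_eq_intCast_iff_dvd_sub y.2 x.2 q₂).2 h2
  rw [dedekindWeight, dedekindWeight, e1, e2]

theorem dvd_columnForm_sub {N : ℤ} (u : ℤ × ℤ) {x y : ℤ × ℤ} (h1 : N ∣ x.1 - y.1)
    (h2 : N ∣ x.2 - y.2) : N ∣ columnForm u x - columnForm u y := by
  have : columnForm u x - columnForm u y = u.1 * (x.2 - y.2) + u.2 * (x.1 - y.1) := by
    simp only [columnForm]; ring
  rw [this]
  exact dvd_add (h2.mul_left _) (h1.mul_left _)

theorem isModPeriodic_dedekindKernel {N : ℕ} (hN : q₁ * q₂ ∣ N) (u v : ℤ × ℤ) {r s : ℤ}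
    (hr : r ∣ N) (hs : s ∣ N) : IsModPeriodic N (dedekindKernel χ₁ χ₂ u v r s) := by
  intro x y h1 h2
  have hq₁ : (q₁ : ℤ) ∣ N := by exact_mod_cast (dvd_mul_right q₁ q₂).trans hN
  have hq₂ : (q₂ : ℤ) ∣ N := by exact_mod_cast (dvd_mul_left q₂ q₁).trans hN
  rw [dedekindKernel, dedekindKernel,
    dedekindWeight_congr χ₁ χ₂ (hq₁.trans h1) (hq₂.trans h2),
    sawtooth_div_eq_of_dvd (hr.trans (dvd_columnForm_sub u h1 h2)),
    sawtooth_div_eq_of_dvd (hs.trans (dvd_columnForm_sub v h1 h2))]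

theorem intCast_natAbs_mul_sign (s : ℤ) : ((s.natAbs : ℕ) : ℂ) * (s.sign : ℂ) = s := by
  have : (s.natAbs : ℤ) * s.sign = s := by rw [mul_comm, Int.sign_mul_natAbs]
  rw [← Int.cast_natCast, ← Int.cast_mul, this]

theorem periodSum_dedekindKernel_distribution {N : ℕ} [NeZero N] (hN : q₁ * q₂ ∣ N)
    {u v : ℤ × ℤ} (hu : (q₂ : ℤ) ∣ u.2) (hv : (q₂ : ℤ) ∣ v.2) {r s t : ℤ}
    (hr : r = q₁ * crossDet u v) (hr0 : r ≠ 0) (hs0 : s ≠ 0) (ht0 : t ≠ 0)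
    (hsr : s * r ∣ N) (htr : t * r ∣ N) :
    periodSum N (dedekindKernel χ₁ χ₂ u v r r) =
      s * t * periodSum N (dedekindKernel χ₁ χ₂ u v (s * r) (t * r)) := by
  set K := dedekindKernel χ₁ χ₂ u v (s * r) (t * r) with hK
  have hr0' : (r : ℝ) ≠ 0 := by exact_mod_cast hr0
  have hs0' : (s : ℝ) ≠ 0 := by exact_mod_cast hs0
  have ht0' : (t : ℝ) ≠ 0 := by exact_mod_cast ht0
  let shift : ℕ → ℕ → ℤ × ℤ := fun k l =>
    (-(q₁ * (k * v.1)) + q₁ * (l * u.1), q₁ * (k * v.2) - q₁ * (l * u.2))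
  have hform1 : ∀ x k l, columnForm u (x + shift k l) = columnForm u x + k * r := by
    intro x k l
    simp only [columnForm, shift, hr, crossDet, Prod.fst_add, Prod.snd_add]
    ring
  have hform2 : ∀ x k l, columnForm v (x + shift k l) = columnForm v x + l * r := by
    intro x k l
    simp only [columnForm, shift, hr, crossDet, Prod.fst_add, Prod.snd_add]
    ring
  have hw : ∀ x k l, dedekindWeight χ₁ χ₂ (x + shift k l) = dedekindWeight χ₁ χ₂ x := by
    intro x k l
    apply dedekindWeight_congr
    · simp only [shift, Prod.fst_add, add_sub_cancel_left]
      exact dvd_add (dvd_neg.2 (dvd_mul_right _ _)) (dvd_mul_right _ _)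
    · simp only [shift, Prod.snd_add, add_sub_cancel_left]
      exact dvd_sub ((hv.mul_left _).mul_left _) ((hu.mul_left _).mul_left _)
  have hdist : ∀ (a : ℤ), a ≠ 0 → ∀ X : ℤ,
      ∑ k ∈ Finset.range a.natAbs, sawtooth (((X + k * r : ℤ) : ℝ) / (a * r : ℤ)) =
        a.sign * sawtooth ((X : ℝ) / r) := by
    intro a ha X
    have ha' : (a : ℝ) ≠ 0 := by exact_mod_cast ha
    rw [← sawtooth_sum_range_natAbs a ha]
    refine Finset.sum_congr rfl fun k _ => ?_
    congr 1
    push_cast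
    field_simp
  have hpt : ∀ x, (s.sign * t.sign : ℂ) * dedekindKernel χ₁ χ₂ u v r r x =
      ∑ k ∈ Finset.range s.natAbs, ∑ l ∈ Finset.range t.natAbs, K (x + shift k l) := by
    intro x
    have e1 : ∑ k ∈ Finset.range s.natAbs, ∑ l ∈ Finset.range t.natAbs, K (x + shift k l) =
        dedekindWeight χ₁ χ₂ x *
          ((∑ k ∈ Finset.range s.natAbs,
            sawtooth (((columnForm u x + k * r : ℤ) : ℝ) / (s * r : ℤ)) : ℝ) : ℂ) *
          ((∑ l ∈ Finset.range t.natAbs,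
            sawtooth (((columnForm v x + l * r : ℤ) : ℝ) / (t * r : ℤ)) : ℝ) : ℂ) := by
      rw [Complex.ofReal_sum, Complex.ofReal_sum, mul_assoc, Finset.sum_mul_sum, Finset.mul_sum]
      refine Finset.sum_congr rfl fun k _ => ?_
      rw [Finset.mul_sum]
      refine Finset.sum_congr rfl fun l _ => ?_
      rw [hK, dedekindKernel, hw, hform1, hform2, mul_assoc]
    rw [e1, hdist s hs0, hdist t ht0, dedekindKernel]
    push_cast
    ring
  have hsum : (s.sign * t.sign : ℂ) * periodSum N (dedekindKernel χ₁ χ₂ u v r r) =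
      (s.natAbs * t.natAbs : ℂ) * periodSum N K := by
    rw [← periodSum_const_mul]
    simp only [hpt]
    rw [periodSum_sum]
    simp only [periodSum_sum, periodSum_add_right
      (isModPeriodic_dedekindKernel χ₁ χ₂ hN u v hsr htr), Finset.sum_const, Finset.card_range,
      nsmul_eq_mul, hK]
    ring
  have hsign : ∀ a : ℤ, a ≠ 0 → (a.sign : ℂ) * a.sign = 1 := by
    intro a ha
    have : a.sign * a.sign = 1 := by
      rcases ha.lt_or_gt with h | h
      · rw [Int.sign_eq_neg_one_of_neg h]; rfl
      · rw [Int.sign_eq_one_of_pos h]; rfl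
    exact_mod_cast this
  rw [← intCast_natAbs_mul_sign s, ← intCast_natAbs_mul_sign t]
  linear_combination (s.sign * t.sign : ℂ) * hsum
    - (t.sign * t.sign : ℂ) * periodSum N (dedekindKernel χ₁ χ₂ u v r r) * hsign s hs0
    - periodSum N (dedekindKernel χ₁ χ₂ u v r r) * hsign t ht0

theorem periodSum_dedekindWeight_mul_columnForm {N : ℕ} [NeZero N] (hN : q₁ * q₂ ∣ N)
    (hχ₁ : χ₁ ≠ 1) {u : ℤ × ℤ} (hu1 : IsCoprime u.1 (q₁ : ℤ)) (hu2 : (q₂ : ℤ) ∣ u.2)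
    {h : ℤ → ℂ} (hh : ∀ a b : ℤ, (N : ℤ) ∣ a - b → h a = h b) :
    periodSum N (fun x => dedekindWeight χ₁ χ₂ x * h (columnForm u x)) = 0 := by
  have hq₁ : (q₁ : ℤ) ∣ N := by exact_mod_cast (dvd_mul_right q₁ q₂).trans hN
  have hq₂ : (q₂ : ℤ) ∣ N := by exact_mod_cast (dvd_mul_left q₂ q₁).trans hN
  have : NeZero q₁ := ⟨by
    rintro rfl
    exact NeZero.ne N (by simpa using hN)⟩
  set g : ℤ × ℤ → ℂ := fun x => dedekindWeight χ₁ χ₂ x * h (columnForm u x) with hg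
  have hgper : IsModPeriodic N g := fun x y h1 h2 => by
    simp only [hg]
    rw [dedekindWeight_congr χ₁ χ₂ (hq₁.trans h1) (hq₂.trans h2),
      hh _ _ (dvd_columnForm_sub u h1 h2)]
  let shift : ZMod q₁ → ℤ × ℤ := fun t => (-(t.cast * u.1), t.cast * u.2)
  have hzero : ∀ x, ∑ t, g (x + shift t) = 0 := by
    intro x
    obtain ⟨a, ha⟩ : IsUnit (u.1 : ZMod q₁) := (ZMod.coe_int_isUnit_iff_isCoprime _ _).2 hu1.symm
    have hterm : ∀ t, g (x + shift t) = (starRingEnd ℂ) (χ₂ (x.2 : ZMod q₂)) *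
        h (columnForm u x) * (starRingEnd ℂ) (χ₁ ((x.1 : ZMod q₁) - t * a)) := by
      intro t
      have hform : columnForm u (x + shift t) = columnForm u x := by
        simp only [columnForm, shift, Prod.fst_add, Prod.snd_add]
        ring
      have e2 : ((x.2 + t.cast * u.2 : ℤ) : ZMod q₂) = x.2 := by
        push_cast
        rw [(ZMod.intCast_zmod_eq_zero_iff_dvd u.2 q₂).2 hu2]
        simp
      have e1 : ((x.1 + -(t.cast * u.1) : ℤ) : ZMod q₁) = x.1 - t * a := by
        push_cast
        rw [ha]
        simp [sub_eq_add_neg]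
      simp only [hg, hform, dedekindWeight, shift, Prod.fst_add, Prod.snd_add, e1, e2]
      ring
    simp only [hterm]
    rw [← Finset.mul_sum, ← map_sum]
    have := Equiv.sum_comp (a.mulRight.trans (Equiv.subLeft (x.1 : ZMod q₁))) χ₁
    simp only [Equiv.trans_apply, Units.mulRight_apply, Equiv.subLeft_apply] at this
    rw [this, MulChar.sum_eq_zero_of_ne_one hχ₁, map_zero, mul_zero]
  have hsum : ∑ t, periodSum N (fun x => g (x + shift t)) = 0 := by
    rw [← periodSum_sum]
    simp only [hzero, periodSum, Finset.sum_const_zero]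
  simp only [periodSum_add_right hgper, Finset.sum_const, Finset.card_univ, nsmul_eq_mul,
    ZMod.card] at hsum
  exact (mul_eq_zero.1 hsum).resolve_left (by exact_mod_cast NeZero.ne q₁)

theorem periodSum_dedekindWeight_mul_periodicBernoulliTwo {N : ℕ} [NeZero N]
    (hN : q₁ * q₂ ∣ N) (hχ₁ : χ₁ ≠ 1) {u : ℤ × ℤ} (hu1 : IsCoprime u.1 (q₁ : ℤ))
    (hu2 : (q₂ : ℤ) ∣ u.2) {m : ℤ} (hm0 : m ≠ 0) (hm : m ∣ N) :
    periodSum N (fun x => dedekindWeight χ₁ χ₂ x *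
      (periodicBernoulliTwo ((columnForm u x : ℝ) / m) : ℝ)) = 0 := by
  refine periodSum_dedekindWeight_mul_columnForm χ₁ χ₂ hN hχ₁ hu1 hu2
    (h := fun a => (periodicBernoulliTwo ((a : ℝ) / m) : ℝ)) fun a b hab => ?_
  obtain ⟨t, ht⟩ := hm.trans hab
  have hm0' : (m : ℝ) ≠ 0 := by exact_mod_cast hm0
  have ha : (a : ℝ) / m = b / m + t := by
    have : (a : ℝ) - b = m * t := by exact_mod_cast ht
    field_simp
    linarith
  simp only [ha, periodicBernoulliTwo, Int.fract_add_intCast]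

theorem crossDet_columnForm_relation (u v w x : ℤ × ℤ) :
    crossDet v w * columnForm u x + crossDet w u * columnForm v x +
      crossDet u v * columnForm w x = 0 := by
  simp only [crossDet, columnForm]
  ring

theorem exists_eq_mul_of_fract_div_eq_zero {a m : ℤ} (hm : m ≠ 0)
    (h : Int.fract ((a : ℝ) / m) = 0) : ∃ t : ℤ, a = t * m := by
  obtain ⟨t, ht⟩ := Int.fract_eq_zero_iff.1 h
  have hm' : (m : ℝ) ≠ 0 := by exact_mod_cast hm
  refine ⟨t, ?_⟩
  rw [eq_div_iff hm'] at ht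
  exact_mod_cast ht.symm

/-- The three-term relation for columns in general position. -/
theorem dedekindSymbol_add_add_of_ne_zero {N : ℕ} [NeZero N] (hq₁ : 1 < q₁)
    (hN : q₁ * q₂ ∣ N) (hχ₁ : χ₁ ≠ 1) {u v w : ℤ × ℤ}
    (hu1 : IsCoprime u.1 (q₁ : ℤ)) (hu2 : (q₂ : ℤ) ∣ u.2)
    (hv1 : IsCoprime v.1 (q₁ : ℤ)) (hv2 : (q₂ : ℤ) ∣ v.2)
    (hw1 : IsCoprime w.1 (q₁ : ℤ)) (hw2 : (q₂ : ℤ) ∣ w.2)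
    (huv : crossDet u v ≠ 0) (hvw : crossDet v w ≠ 0) (hwu : crossDet w u ≠ 0)
    (hdvd : (q₁ * crossDet v w) * (q₁ * crossDet w u) * (q₁ * crossDet u v) ∣ (N : ℤ)) :
    dedekindSymbol χ₁ χ₂ N u v + dedekindSymbol χ₁ χ₂ N v w + dedekindSymbol χ₁ χ₂ N w u = 0 := by
  have hrel := crossDet_columnForm_relation u v w
  have hq0 : (q₁ : ℤ) ≠ 0 := by omega
  unfold dedekindSymbol
  obtain ⟨p, hp⟩ : ∃ p : ℤ, p = q₁ * crossDet v w := ⟨_, rfl⟩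
  obtain ⟨q, hq⟩ : ∃ q : ℤ, q = q₁ * crossDet w u := ⟨_, rfl⟩
  obtain ⟨r, hr⟩ : ∃ r : ℤ, r = q₁ * crossDet u v := ⟨_, rfl⟩
  have hp0 : p ≠ 0 := hp ▸ mul_ne_zero hq0 hvw
  have hq0' : q ≠ 0 := hq ▸ mul_ne_zero hq0 hwu
  have hr0 : r ≠ 0 := hr ▸ mul_ne_zero hq0 huv
  rw [← hp, ← hq, ← hr] at hdvd ⊢
  have hqr : q * r ∣ (N : ℤ) := (Dvd.intro_left p (by ring)).trans hdvd
  have hpr : p * r ∣ (N : ℤ) := (Dvd.intro_left q (by ring)).trans hdvd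
  have hpq : p * q ∣ (N : ℤ) := (Dvd.intro_left r (by ring)).trans hdvd
  rw [periodSum_dedekindKernel_distribution χ₁ χ₂ hN hu2 hv2 hr hr0 hq0' hp0 hqr hpr,
    periodSum_dedekindKernel_distribution χ₁ χ₂ hN hv2 hw2 hp hp0 hr0 hq0'
      (mul_comm p r ▸ hpr) (mul_comm p q ▸ hpq),
    periodSum_dedekindKernel_distribution χ₁ χ₂ hN hw2 hu2 hq hq0' hp0 hr0
      hpq (mul_comm q r ▸ hqr), mul_comm r p, mul_comm q p, mul_comm r q]
  have hpt : ∀ x, dedekindKernel χ₁ χ₂ u v (q * r) (p * r) x +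
      (dedekindKernel χ₁ χ₂ v w (p * r) (p * q) x + dedekindKernel χ₁ χ₂ w u (p * q) (q * r) x) =
      (-(1 / 2) : ℂ) * (dedekindWeight χ₁ χ₂ x *
          (periodicBernoulliTwo ((columnForm u x : ℝ) / (q * r : ℤ)) : ℝ) +
        (dedekindWeight χ₁ χ₂ x *
          (periodicBernoulliTwo ((columnForm v x : ℝ) / (p * r : ℤ)) : ℝ) +
        dedekindWeight χ₁ χ₂ x *
          (periodicBernoulliTwo ((columnForm w x : ℝ) / (p * q : ℤ)) : ℝ))) := by
    intro x
    have hadd : (columnForm u x : ℝ) / (q * r : ℤ) + (columnForm v x : ℝ) / (p * r : ℤ) +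
        (columnForm w x : ℝ) / (p * q : ℤ) = 0 := by
      have hp' : (p : ℝ) ≠ 0 := by exact_mod_cast hp0
      have hq' : (q : ℝ) ≠ 0 := by exact_mod_cast hq0'
      have hr' : (r : ℝ) ≠ 0 := by exact_mod_cast hr0
      have : (p : ℝ) * columnForm u x + q * columnForm v x + r * columnForm w x = 0 := by
        have : p * columnForm u x + q * columnForm v x + r * columnForm w x = 0 := by
          rw [hp, hq, hr]
          linear_combination (q₁ : ℤ) * hrel x
        exact_mod_cast this
      push_cast
      field_simp
      linarith
    by_cases hint : Int.fract ((columnForm u x : ℝ) / (q * r : ℤ)) = 0 ∧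
        Int.fract ((columnForm v x : ℝ) / (p * r : ℤ)) = 0
    · obtain ⟨a, ha⟩ := exists_eq_mul_of_fract_div_eq_zero (mul_ne_zero hq0' hr0) hint.1
      obtain ⟨b, hb⟩ := exists_eq_mul_of_fract_div_eq_zero (mul_ne_zero hp0 hr0) hint.2
      have hx : x.1 = q₁ * (u.1 * (b * p) - v.1 * (a * q)) := by
        apply mul_right_cancel₀ huv
        have h1 : x.1 * crossDet u v = u.1 * columnForm v x - v.1 * columnForm u x := by
          simp only [crossDet, columnForm]
          ring
        rw [h1, ha, hb]
        linear_combination (u.1 * b * p - v.1 * a * q) * hr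
      have hz : dedekindWeight χ₁ χ₂ x = 0 := by
        have hx0 : (x.1 : ZMod q₁) = 0 := by
          rw [hx]; simp
        have : Fact (1 < q₁) := ⟨hq₁⟩
        rw [dedekindWeight, hx0, MulChar.map_zero, map_zero, mul_zero]
      simp only [dedekindKernel, hz]
      ring
    · have h := congrArg (Complex.ofReal) (sawtooth_mul_add_of_add_eq_zero hadd hint)
      push_cast at h
      simp only [dedekindKernel]
      push_cast
      linear_combination dedekindWeight χ₁ χ₂ x * h
  have hsum : periodSum N (dedekindKernel χ₁ χ₂ u v (q * r) (p * r)) +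
      (periodSum N (dedekindKernel χ₁ χ₂ v w (p * r) (p * q)) +
        periodSum N (dedekindKernel χ₁ χ₂ w u (p * q) (q * r))) = 0 := by
    rw [← periodSum_add, ← periodSum_add]
    simp only [hpt]
    rw [periodSum_const_mul, periodSum_add, periodSum_add,
      periodSum_dedekindWeight_mul_periodicBernoulliTwo χ₁ χ₂ hN hχ₁ hu1 hu2
        (mul_ne_zero hq0' hr0) hqr,
      periodSum_dedekindWeight_mul_periodicBernoulliTwo χ₁ χ₂ hN hχ₁ hv1 hv2
        (mul_ne_zero hp0 hr0) hpr,
      periodSum_dedekindWeight_mul_periodicBernoulliTwo χ₁ χ₂ hN hχ₁ hw1 hw2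
        (mul_ne_zero hp0 hq0') hpq]
    simp
  linear_combination (p * q * r : ℂ) * hsum

theorem crossDet_swap (u v : ℤ × ℤ) : crossDet v u = -crossDet u v := by
  simp only [crossDet]; ring

theorem crossDet_neg_left (u v : ℤ × ℤ) : crossDet (-u) v = -crossDet u v := by
  simp only [crossDet, Prod.fst_neg, Prod.snd_neg]; ring

theorem columnForm_neg_left (u x : ℤ × ℤ) : columnForm (-u) x = -columnForm u x := by
  simp only [columnForm, Prod.fst_neg, Prod.snd_neg]; ring

theorem dedekindSymbol_swap (N : ℕ) [NeZero N] (u v : ℤ × ℤ) :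
    dedekindSymbol χ₁ χ₂ N v u = -dedekindSymbol χ₁ χ₂ N u v := by
  have h : ∀ r x, dedekindKernel χ₁ χ₂ v u (-r) (-r) x = dedekindKernel χ₁ χ₂ u v r r x := by
    intro r x
    simp only [dedekindKernel, Int.cast_neg, div_neg, sawtooth_neg, Complex.ofReal_neg]
    ring
  simp only [dedekindSymbol, crossDet_swap u v, mul_neg, periodSum, h, Int.cast_neg, neg_mul]

theorem dedekindSymbol_neg_left (N : ℕ) [NeZero N] (u v : ℤ × ℤ) :
    dedekindSymbol χ₁ χ₂ N (-u) v = dedekindSymbol χ₁ χ₂ N u v := by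
  have h : ∀ r x, dedekindKernel χ₁ χ₂ (-u) v (-r) (-r) x =
      -dedekindKernel χ₁ χ₂ u v r r x := by
    intro r x
    simp only [dedekindKernel, columnForm_neg_left, Int.cast_neg, div_neg, neg_div, neg_neg,
      sawtooth_neg, Complex.ofReal_neg]
    ring
  simp only [dedekindSymbol, crossDet_neg_left, mul_neg, periodSum, h, Int.cast_neg, neg_mul,
    Finset.sum_neg_distrib, neg_neg]

theorem eq_or_eq_neg_of_crossDet_eq_zero {u v : ℤ × ℤ} (hu : IsCoprime u.1 u.2)
    (hv : IsCoprime v.1 v.2) (h : crossDet u v = 0) : v = u ∨ v = -u := by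
  obtain ⟨a, b, hab⟩ := hu
  obtain ⟨c, d, hcd⟩ := hv
  unfold crossDet at h
  have h1 : v.1 = (a * v.1 + b * v.2) * u.1 := by linear_combination (-v.1) * hab - b * h
  have h2 : v.2 = (a * v.1 + b * v.2) * u.2 := by linear_combination (-v.2) * hab + a * h
  have hunit : IsUnit (a * v.1 + b * v.2) :=
    IsUnit.of_mul_eq_one (c * u.1 + d * u.2) (by linear_combination hcd - c * h1 - d * h2)
  rcases Int.isUnit_iff.1 hunit with hk | hk
  · left
    ext
    · rw [h1, hk, one_mul]
    · rw [h2, hk, one_mul]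
  · right
    ext
    · rw [h1, hk, Prod.fst_neg, neg_one_mul]
    · rw [h2, hk, Prod.snd_neg, neg_one_mul]

theorem dedekindSymbol_eq_zero (N : ℕ) [NeZero N] {u v : ℤ × ℤ} (h : crossDet u v = 0) :
    dedekindSymbol χ₁ χ₂ N u v = 0 := by
  simp [dedekindSymbol, h]

theorem dedekindSymbol_add_add_of_eq_zero (N : ℕ) [NeZero N] {u v : ℤ × ℤ} (w : ℤ × ℤ)
    (hu : IsCoprime u.1 u.2) (hv : IsCoprime v.1 v.2) (h : crossDet u v = 0) :
    dedekindSymbol χ₁ χ₂ N u v + dedekindSymbol χ₁ χ₂ N v w + dedekindSymbol χ₁ χ₂ N w u = 0 := by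
  rw [dedekindSymbol_eq_zero χ₁ χ₂ N h, dedekindSymbol_swap χ₁ χ₂ N u w]
  rcases eq_or_eq_neg_of_crossDet_eq_zero hu hv h with rfl | rfl
  · ring
  · rw [dedekindSymbol_neg_left]; ring

/-- The three-term relation for primitive columns. -/
theorem dedekindSymbol_add_add {N : ℕ} [NeZero N] (hq₁ : 1 < q₁)
    (hN : q₁ * q₂ ∣ N) (hχ₁ : χ₁ ≠ 1) {u v w : ℤ × ℤ}
    (hu : IsCoprime u.1 (q₁ * u.2)) (hu2 : (q₂ : ℤ) ∣ u.2)
    (hv : IsCoprime v.1 (q₁ * v.2)) (hv2 : (q₂ : ℤ) ∣ v.2)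
    (hw : IsCoprime w.1 (q₁ * w.2)) (hw2 : (q₂ : ℤ) ∣ w.2)
    (hdvd : crossDet v w ≠ 0 → crossDet w u ≠ 0 → crossDet u v ≠ 0 →
      (q₁ * crossDet v w) * (q₁ * crossDet w u) * (q₁ * crossDet u v) ∣ (N : ℤ)) :
    dedekindSymbol χ₁ χ₂ N u v + dedekindSymbol χ₁ χ₂ N v w + dedekindSymbol χ₁ χ₂ N w u = 0 := by
  have hu' := hu.of_mul_right_right
  have hv' := hv.of_mul_right_right
  have hw' := hw.of_mul_right_right
  by_cases huv : crossDet u v = 0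
  · exact dedekindSymbol_add_add_of_eq_zero χ₁ χ₂ N w hu' hv' huv
  by_cases hvw : crossDet v w = 0
  · rw [← dedekindSymbol_add_add_of_eq_zero χ₁ χ₂ N u hv' hw' hvw]; ring
  by_cases hwu : crossDet w u = 0
  · rw [← dedekindSymbol_add_add_of_eq_zero χ₁ χ₂ N v hw' hu' hwu]; ring
  exact dedekindSymbol_add_add_of_ne_zero χ₁ χ₂ hq₁ hN hχ₁ hu.of_mul_right_left hu2
    hv.of_mul_right_left hv2 hw.of_mul_right_left hw2 huv hvw hwu (hdvd hvw hwu huv)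

theorem dedekindWeight_linear {a b c d : ℤ} (hc : (q₂ : ℤ) ∣ c) (x : ℤ × ℤ) :
    dedekindWeight χ₁ χ₂ (a * x.1 - b * q₁ * x.2, -(c * x.1) + d * x.2) =
      dedekindWeight χ₁ χ₂ (a, d) * dedekindWeight χ₁ χ₂ x := by
  have hc' := (ZMod.intCast_zmod_eq_zero_iff_dvd c q₂).2 hc
  simp only [dedekindWeight]
  push_cast
  rw [hc']
  simp only [CharP.cast_eq_zero, mul_zero, zero_mul, sub_zero, neg_zero, zero_add, map_mul]
  ring

/-- Equivariance of the Dedekind symbol under a unimodular change of columns. -/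
theorem dedekindSymbol_linear {N : ℕ} [NeZero N] (hN : q₁ * q₂ ∣ N) {a b c d : ℤ}
    (hdet : a * d - b * (q₁ * c) = 1) (hc : (q₂ : ℤ) ∣ c) {a' c' : ℤ}
    (hc' : c' ≠ 0 → q₁ * c' ∣ (N : ℤ)) :
    dedekindSymbol χ₁ χ₂ N (a, c) (a * a' + b * (q₁ * c'), c * a' + d * c') =
      dedekindWeight χ₁ χ₂ (a, d) * dedekindSymbol χ₁ χ₂ N (1, 0) (a', c') := by
  have hcross : crossDet (a, c) (a * a' + b * (q₁ * c'), c * a' + d * c') = c' := by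
    simp only [crossDet]
    linear_combination c' * hdet
  have hcross' : crossDet (1, 0) (a', c') = c' := by simp [crossDet]
  by_cases h0 : c' = 0
  · rw [dedekindSymbol_eq_zero χ₁ χ₂ N (hcross.trans h0),
      dedekindSymbol_eq_zero χ₁ χ₂ N (hcross'.trans h0), mul_zero]
  unfold dedekindSymbol
  rw [hcross, hcross']
  have hdet' : (a : ZMod N) * d - b * (q₁ * c) = 1 := by
    exact_mod_cast congrArg (Int.cast : ℤ → ZMod N) hdet
  let e : ZMod N × ZMod N ≃ ZMod N × ZMod N :=
    { toFun := fun x => (a * x.1 - b * q₁ * x.2, -(c * x.1) + d * x.2)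
      invFun := fun x => (d * x.1 + b * q₁ * x.2, c * x.1 + a * x.2)
      left_inv := fun x => by
        ext
        · linear_combination x.1 * hdet'
        · linear_combination x.2 * hdet'
      right_inv := fun x => by
        ext
        · linear_combination x.1 * hdet'
        · linear_combination x.2 * hdet' }
  rw [← periodSum_comp (isModPeriodic_dedekindKernel χ₁ χ₂ hN _ _ (hc' h0) (hc' h0))
    (fun x => (a * x.1 - b * q₁ * x.2, -(c * x.1) + d * x.2)) e (fun x => by simp [e])]
  have hpt : ∀ x : ℤ × ℤ, dedekindKernel χ₁ χ₂ (a, c)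
      (a * a' + b * (q₁ * c'), c * a' + d * c') (q₁ * c') (q₁ * c')
      (a * x.1 - b * q₁ * x.2, -(c * x.1) + d * x.2) =
      dedekindWeight χ₁ χ₂ (a, d) *
        dedekindKernel χ₁ χ₂ (1, 0) (a', c') (q₁ * c') (q₁ * c') x := by
    intro x
    have h1 : columnForm (a, c) (a * x.1 - b * q₁ * x.2, -(c * x.1) + d * x.2) =
        columnForm (1, 0) x := by
      simp only [columnForm]
      linear_combination x.2 * hdet
    have h2 : columnForm (a * a' + b * (q₁ * c'), c * a' + d * c')
        (a * x.1 - b * q₁ * x.2, -(c * x.1) + d * x.2) = columnForm (a', c') x := by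
      simp only [columnForm]
      linear_combination (a' * x.2 + c' * x.1) * hdet
    rw [dedekindKernel, h1, h2, dedekindWeight_linear χ₁ χ₂ hc, dedekindKernel]
    ring
  simp only [hpt]
  rw [periodSum_const_mul]
  ring

theorem periodSum_dedekindKernel_eq_newformDedekindSum {N : ℕ} [NeZero N] (hq₁ : 0 < q₁)
    (hN : q₁ * q₂ ∣ N) {a c : ℤ} (hc0 : 0 < c) (hc : (q₂ : ℤ) ∣ c) (hcN : q₁ * c ∣ (N : ℤ)) :
    (N : ℂ) ^ 2 * newformDedekindSum χ₁ χ₂ a (q₁ * c) = q₁ * ((q₁ * c : ℤ) : ℂ) *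
      periodSum N (dedekindKernel χ₁ χ₂ (1, 0) (a, c) (q₁ * c) (q₁ * c)) := by
  obtain ⟨s, hs⟩ := (dvd_mul_right q₁ q₂).trans hN
  obtain ⟨m, rfl⟩ : ∃ m : ℕ, c = m := ⟨c.toNat, by omega⟩
  have hm0 : 0 < m := by exact_mod_cast hc0
  obtain ⟨t, ht⟩ : q₁ * m ∣ N := by exact_mod_cast hcN
  have hq₁' : (q₁ : ℝ) ≠ 0 := by exact_mod_cast hq₁.ne'
  have hm' : (m : ℝ) ≠ 0 := by exact_mod_cast hm0.ne'
  rw [periodSum_eq_of_periodic hs ht (s := s) (t := t)]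
  · have htoNat : ((q₁ : ℤ) * m).toNat = q₁ * m := by
      rw [← Nat.cast_mul, Int.toNat_natCast]
    rw [newformDedekindSum, htoNat]
    have hterm : ∀ j n : ℕ, dedekindKernel χ₁ χ₂ (1, 0) (a, (m : ℤ)) (q₁ * m) (q₁ * m)
        ((n : ℤ), (j : ℤ)) =
        (starRingEnd ℂ) (χ₂ (j : ZMod q₂)) * (starRingEnd ℂ) (χ₁ (n : ZMod q₁)) *
        (sawtooth ((j : ℝ) / ((q₁ * m : ℤ) : ℝ)) : ℝ) *
        (sawtooth ((n : ℝ) / (q₁ : ℝ) + (a : ℝ) * (j : ℝ) / ((q₁ * m : ℤ) : ℝ)) : ℝ) := by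
      intro j n
      have h1 : ((columnForm (1, 0) ((n : ℤ), (j : ℤ)) : ℤ) : ℝ) = j := by simp [columnForm]
      have h2 : ((columnForm (a, (m : ℤ)) ((n : ℤ), (j : ℤ)) : ℤ) : ℝ) / ((q₁ * m : ℤ) : ℝ) =
          (n : ℝ) / (q₁ : ℝ) + (a : ℝ) * (j : ℝ) / ((q₁ * m : ℤ) : ℝ) := by
        simp only [columnForm]
        push_cast
        field_simp
        ring
      rw [dedekindKernel, h1, h2, dedekindWeight]
      simp only [Int.cast_natCast]
    simp only [hterm]
    have hNs : (N : ℂ) = q₁ * s := by exact_mod_cast hs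
    have hNt : (N : ℂ) = (q₁ * m) * t := by exact_mod_cast ht
    have hNN : (N : ℂ) ^ 2 = q₁ * ((q₁ * m : ℤ) : ℂ) * (s * t) := by
      rw [sq]
      nth_rewrite 1 [hNs]
      rw [hNt]
      push_cast
      ring
    rw [hNN]
    ring
  · intro j n
    have h1 : columnForm (1, 0) (n + q₁, j) = columnForm (1, 0) (n, j) := by simp [columnForm]
    have h2 : columnForm (a, (m : ℤ)) (n + q₁, j) = columnForm (a, (m : ℤ)) (n, j) + q₁ * m := by
      simp only [columnForm]; ring
    simp only [dedekindKernel]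
    rw [dedekindWeight_congr χ₁ χ₂ (x := (n + q₁, j)) (y := (n, j)) (by simp) (by simp), h1, h2,
      sawtooth_div_eq_of_dvd (k := q₁ * m) (m := _ + _) (by rw [add_sub_cancel_left])]
  · intro n j
    have hk : ((q₁ * m : ℕ) : ℤ) = q₁ * m := by push_cast; rfl
    simp only [dedekindKernel, hk]
    rw [dedekindWeight_congr χ₁ χ₂ (x := (n, j + q₁ * m)) (y := (n, j)) (by simp)
        (by simpa using hc.mul_left _),
      sawtooth_div_eq_of_dvd (m := columnForm (1, 0) (n, j + q₁ * m))
        (m' := columnForm (1, 0) (n, j)) (by simp [columnForm]),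
      sawtooth_div_eq_of_dvd (m := columnForm (a, (m : ℤ)) (n, j + q₁ * m))
        (m' := columnForm (a, (m : ℤ)) (n, j))
        ⟨a, by simp only [columnForm]; ring⟩]

theorem SGamma_eq_dedekindSymbol {N : ℕ} [NeZero N] (hq₁ : 0 < q₁) (hN : q₁ * q₂ ∣ N)
    {γ : Matrix.SpecialLinearGroup (Fin 2) ℤ} {a c : ℤ} (ha : γ 0 0 = a) (hγ : γ 1 0 = q₁ * c)
    (hc : (q₂ : ℤ) ∣ c) (hcN : c ≠ 0 → q₁ * c ∣ (N : ℤ)) :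
    (N : ℂ) ^ 2 * SGamma χ₁ χ₂ γ = q₁ * dedekindSymbol χ₁ χ₂ N (1, 0) (a, c) := by
  have hq₁' : (0 : ℤ) < q₁ := by exact_mod_cast hq₁
  have hcross : ∀ a c, crossDet (1, 0) (a, c) = c := by simp [crossDet]
  unfold SGamma
  rw [ha, hγ]
  rcases lt_trichotomy c 0 with h | h | h
  · have hlt : (q₁ : ℤ) * c < 0 := mul_neg_of_pos_of_neg hq₁' h
    have h1 := periodSum_dedekindKernel_eq_newformDedekindSum χ₁ χ₂ hq₁ hN (a := -a)
      (neg_pos.2 h) (dvd_neg.2 hc) (by rw [mul_neg]; exact neg_dvd.2 (hcN h.ne))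
    rw [if_neg hlt.not_gt, if_pos hlt, ← mul_neg, h1,
      ← dedekindSymbol_neg_left χ₁ χ₂ N (1, 0) (a, c), ← neg_neg (dedekindSymbol _ _ _ _ _),
      ← dedekindSymbol_swap, ← dedekindSymbol_neg_left, dedekindSymbol_swap, neg_neg,
      dedekindSymbol_neg_left, Prod.neg_mk, dedekindSymbol, hcross, mul_assoc]
  · have : dedekindSymbol χ₁ χ₂ N (1, 0) (a, c) = 0 :=
      dedekindSymbol_eq_zero χ₁ χ₂ N ((hcross a c).trans h)
    rw [this, h]
    simp
  · have hlt : 0 < (q₁ : ℤ) * c := mul_pos hq₁' h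
    rw [if_pos hlt, periodSum_dedekindKernel_eq_newformDedekindSum χ₁ χ₂ hq₁ hN h hc (hcN h.ne'),
      dedekindSymbol, hcross, mul_assoc]

theorem conj_apply_eq_of_mul_eq_one {q : ℕ} (χ : DirichletCharacter ℂ q) {a d : ℤ}
    (h : (a : ZMod q) * d = 1) : (starRingEnd ℂ) (χ (a : ZMod q)) = χ (d : ZMod q) := by
  have h1 : χ (a : ZMod q) * χ (d : ZMod q) = 1 := by rw [← map_mul, h, map_one]
  have h2 : ‖χ (a : ZMod q)‖ = 1 := by
    obtain ⟨u, hu⟩ := IsUnit.of_mul_eq_one _ h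
    rw [← hu]
    exact χ.unit_norm_eq_one u
  have h3 : (starRingEnd ℂ) (χ (a : ZMod q)) * χ (a : ZMod q) = 1 := by
    rw [mul_comm, Complex.mul_conj, Complex.normSq_eq_norm_sq, h2]
    simp
  linear_combination χ (d : ZMod q) * h3 - (starRingEnd ℂ) (χ (a : ZMod q)) * h1

/-- The crossed homomorphism property on `Γ₀(q₁q₂)`, which only needs `χ₁` to be nontrivial. -/
theorem SGamma_mul (hq₁ : 1 < q₁) (hq₂ : 0 < q₂) (hχ₁ : χ₁ ≠ 1)
    {γ₁ γ₂ : Matrix.SpecialLinearGroup (Fin 2) ℤ}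
    (h₁ : γ₁ ∈ CongruenceSubgroup.Gamma0 (q₁ * q₂))
    (h₂ : γ₂ ∈ CongruenceSubgroup.Gamma0 (q₁ * q₂)) :
    SGamma χ₁ χ₂ (γ₁ * γ₂) = SGamma χ₁ χ₂ γ₁ +
      (χ₁ ((γ₁ 1 1 : ℤ) : ZMod q₁) * (starRingEnd ℂ) (χ₂ ((γ₁ 1 1 : ℤ) : ZMod q₂))) *
        SGamma χ₁ χ₂ γ₂ := by
  have hlower : ∀ γ ∈ CongruenceSubgroup.Gamma0 (q₁ * q₂),
      ∃ c : ℤ, (q₂ : ℤ) ∣ c ∧ γ 1 0 = q₁ * c := by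
    intro γ hγ
    rw [CongruenceSubgroup.Gamma0_mem, ZMod.intCast_zmod_eq_zero_iff_dvd] at hγ
    obtain ⟨t, ht⟩ := hγ
    exact ⟨q₂ * t, dvd_mul_right _ _, by rw [ht]; push_cast; ring⟩
  have hdet : ∀ γ : Matrix.SpecialLinearGroup (Fin 2) ℤ,
      γ 0 0 * γ 1 1 - γ 0 1 * γ 1 0 = 1 := fun γ => by
    have := γ.det_coe
    rwa [Matrix.det_fin_two] at this
  obtain ⟨c₁, hc₁, hγ₁⟩ := hlower γ₁ h₁
  obtain ⟨c₂, hc₂, hγ₂⟩ := hlower γ₂ h₂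
  have hd₁ := hdet γ₁
  have hd₃ := hdet (γ₁ * γ₂)
  have ha₃ : (γ₁ * γ₂) 0 0 = γ₁ 0 0 * γ₂ 0 0 + γ₁ 0 1 * (q₁ * c₂) := by
    rw [← hγ₂]
    simp [Matrix.mul_apply, Fin.sum_univ_two]
  have hγ₃ : (γ₁ * γ₂) 1 0 = q₁ * (c₁ * γ₂ 0 0 + γ₁ 1 1 * c₂) := by
    have : (γ₁ * γ₂) 1 0 = γ₁ 1 0 * γ₂ 0 0 + γ₁ 1 1 * γ₂ 1 0 := by
      simp [Matrix.mul_apply, Fin.sum_univ_two]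
    rw [this, hγ₁, hγ₂]
    ring
  rw [hγ₁] at hd₁
  rw [hγ₃, ha₃] at hd₃
  generalize (γ₁ * γ₂) 0 1 = b₃ at hd₃
  generalize (γ₁ * γ₂) 1 1 = d₃ at hd₃
  obtain ⟨a₃, hv₃⟩ : ∃ a, a = γ₁ 0 0 * γ₂ 0 0 + γ₁ 0 1 * (q₁ * c₂) := ⟨_, rfl⟩
  obtain ⟨c₃, hw₃⟩ : ∃ c, c = c₁ * γ₂ 0 0 + γ₁ 1 1 * c₂ := ⟨_, rfl⟩
  have hc₃ : (q₂ : ℤ) ∣ c₃ := hw₃ ▸ dvd_add (hc₁.mul_right _) (hc₂.mul_left _)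
  have hq₁0 : (q₁ : ℤ) ≠ 0 := by omega
  let f : ℤ → ℤ := fun c => if c = 0 then 1 else q₁ * c
  have hf0 : ∀ c, f c ≠ 0 := fun c => by
    simp only [f]
    split_ifs with h
    · exact one_ne_zero
    · exact mul_ne_zero hq₁0 h
  have hf : ∀ {c}, c ≠ 0 → f c = q₁ * c := fun h => if_neg h
  let N : ℕ := q₁ * q₂ * (f c₁ * f c₂ * f c₃).natAbs
  have hN0 : N ≠ 0 := mul_ne_zero (mul_ne_zero (by omega) hq₂.ne')
    (Int.natAbs_ne_zero.2 (mul_ne_zero (mul_ne_zero (hf0 _) (hf0 _)) (hf0 _)))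
  have : NeZero N := ⟨hN0⟩
  have hN : q₁ * q₂ ∣ N := dvd_mul_right _ _
  have hfN : f c₁ * f c₂ * f c₃ ∣ (N : ℤ) :=
    (Int.dvd_natAbs.2 dvd_rfl).trans (by
      simp only [N]; rw [Nat.cast_mul (q₁ * q₂)]; exact dvd_mul_left _ _)
  have hN₁ : c₁ ≠ 0 → q₁ * c₁ ∣ (N : ℤ) := fun h =>
    hf h ▸ (Dvd.intro (f c₂ * f c₃) (by ring)).trans hfN
  have hN₂ : c₂ ≠ 0 → q₁ * c₂ ∣ (N : ℤ) := fun h =>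
    hf h ▸ (Dvd.intro (f c₁ * f c₃) (by ring)).trans hfN
  have hN₃ : c₃ ≠ 0 → q₁ * c₃ ∣ (N : ℤ) := fun h =>
    hf h ▸ (Dvd.intro (f c₁ * f c₂) (by ring)).trans hfN
  have hS₁ := SGamma_eq_dedekindSymbol χ₁ χ₂ (by omega) hN rfl hγ₁ hc₁ hN₁
  have hS₂ := SGamma_eq_dedekindSymbol χ₁ χ₂ (by omega) hN rfl hγ₂ hc₂ hN₂
  have hS₃ := SGamma_eq_dedekindSymbol χ₁ χ₂ (by omega) hN (ha₃.trans hv₃.symm)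
    (hγ₃.trans (by rw [hw₃])) hc₃ hN₃
  have hlin := dedekindSymbol_linear χ₁ χ₂ hN hd₁ hc₁ (a' := γ₂ 0 0) hN₂
  rw [← hv₃, ← hw₃] at hlin hd₃
  have hcop : ∀ {a b c d : ℤ}, a * d - b * (q₁ * c) = 1 → IsCoprime a (q₁ * c) :=
    fun {a b c d} h => ⟨d, -b, by linear_combination h⟩
  have hcross₂ : crossDet (γ₁ 0 0, c₁) (a₃, c₃) = c₂ := by
    simp only [crossDet, hv₃, hw₃]
    linear_combination c₂ * hd₁
  have hcross₁ : crossDet (1, 0) (γ₁ 0 0, c₁) = c₁ := by simp [crossDet]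
  have hcross₃ : crossDet (a₃, c₃) (1, 0) = -c₃ := by simp [crossDet]
  have h3 := dedekindSymbol_add_add χ₁ χ₂ hq₁ hN hχ₁ (u := (1, 0)) (v := (γ₁ 0 0, c₁))
    (w := (a₃, c₃)) isCoprime_one_left (dvd_zero _) (hcop hd₁) hc₁ (hcop hd₃) hc₃ (by
      rw [hcross₁, hcross₂, hcross₃]
      intro k₂ k₃ k₁
      rw [← hf k₁, ← hf k₂, mul_neg, ← hf (neg_ne_zero.1 k₃)]
      exact (Dvd.intro (-1) (by ring)).trans hfN)
  have hψ : dedekindWeight χ₁ χ₂ (γ₁ 0 0, γ₁ 1 1) =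
      χ₁ ((γ₁ 1 1 : ℤ) : ZMod q₁) * (starRingEnd ℂ) (χ₂ ((γ₁ 1 1 : ℤ) : ZMod q₂)) := by
    have : ((γ₁ 0 0 : ℤ) : ZMod q₁) * ((γ₁ 1 1 : ℤ) : ZMod q₁) = 1 := by
      have := congrArg (Int.cast : ℤ → ZMod q₁) hd₁
      push_cast at this
      simpa using this
    rw [dedekindWeight, conj_apply_eq_of_mul_eq_one χ₁ this, mul_comm]
  rw [hlin, hψ, dedekindSymbol_swap χ₁ χ₂ N (1, 0) (a₃, c₃)] at h3
  have hN' : (N : ℂ) ^ 2 ≠ 0 := pow_ne_zero 2 (by exact_mod_cast hN0)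
  apply mul_left_cancel₀ hN'
  rw [mul_add, mul_left_comm, hS₁, hS₂, hS₃]
  linear_combination -(q₁ : ℂ) * h3

end DedekindKernel

/-- The crossed homomorphism property: for `γ₁, γ₂ ∈ Γ₀(q₁q₂)`,
`S_{χ₁,χ₂}(γ₁γ₂) = S_{χ₁,χ₂}(γ₁) + ψ(γ₁) S_{χ₁,χ₂}(γ₂)` where `ψ = χ₁ χ̄₂` is evaluated at
the lower-right entry of `γ₁`.  In particular the restriction of `S_{χ₁,χ₂}` to
`Γ₁(q₁q₂)` is a group homomorphism into `(ℂ, +)`. -/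
theorem crossed_homomorphism_property {q₁ q₂ : ℕ} (hq₁ : 1 < q₁) (hq₂ : 1 < q₂)
    (χ₁ : DirichletCharacter ℂ q₁) (χ₂ : DirichletCharacter ℂ q₂)
    (hχ₁ : DirichletCharacter.IsPrimitive χ₁) (hχ₂ : DirichletCharacter.IsPrimitive χ₂)
    (hpar : χ₁ (-1) * χ₂ (-1) = 1) :
    (∀ γ₁ ∈ CongruenceSubgroup.Gamma0 (q₁ * q₂), ∀ γ₂ ∈ CongruenceSubgroup.Gamma0 (q₁ * q₂),
      SGamma χ₁ χ₂ (γ₁ * γ₂) = SGamma χ₁ χ₂ γ₁ +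
        (χ₁ (((γ₁ : Matrix (Fin 2) (Fin 2) ℤ) 1 1 : ℤ) : ZMod q₁) *
          (starRingEnd ℂ) (χ₂ (((γ₁ : Matrix (Fin 2) (Fin 2) ℤ) 1 1 : ℤ) : ZMod q₂))) *
          SGamma χ₁ χ₂ γ₂) ∧
    (∀ γ₁ ∈ CongruenceSubgroup.Gamma1 (q₁ * q₂), ∀ γ₂ ∈ CongruenceSubgroup.Gamma1 (q₁ * q₂),
      SGamma χ₁ χ₂ (γ₁ * γ₂) = SGamma χ₁ χ₂ γ₁ + SGamma χ₁ χ₂ γ₂) := by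
  have hχ₁' : χ₁ ≠ 1 := by
    rintro rfl
    have : NeZero q₁ := ⟨by omega⟩
    rw [DirichletCharacter.isPrimitive_def, DirichletCharacter.conductor_one] at hχ₁
    omega
  have hmul := fun γ₁ (h₁ : γ₁ ∈ CongruenceSubgroup.Gamma0 (q₁ * q₂)) γ₂
    (h₂ : γ₂ ∈ CongruenceSubgroup.Gamma0 (q₁ * q₂)) =>
      SGamma_mul χ₁ χ₂ hq₁ (by omega) hχ₁' h₁ h₂
  refine ⟨hmul, fun γ₁ h₁ γ₂ h₂ => ?_⟩
  have hle := CongruenceSubgroup.Gamma1_in_Gamma0 (q₁ * q₂)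
  have hd := ((CongruenceSubgroup.Gamma1_mem _ _).1 h₁).2.1
  have hd' : ((q₁ * q₂ : ℕ) : ℤ) ∣ γ₁ 1 1 - 1 := by
    rw [← ZMod.intCast_zmod_eq_zero_iff_dvd]
    push_cast
    rw [hd, sub_self]
  have hone : ∀ q : ℕ, q ∣ q₁ * q₂ → ((γ₁ 1 1 : ℤ) : ZMod q) = 1 := by
    intro q hq
    have := (ZMod.intCast_zmod_eq_zero_iff_dvd _ q).2 ((Int.natCast_dvd_natCast.2 hq).trans hd')
    push_cast at this
    exact sub_eq_zero.1 this
  rw [hmul γ₁ (hle h₁) γ₂ (hle h₂), hone q₁ (dvd_mul_right _ _), hone q₂ (dvd_mul_left _ _)]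
  simp
end
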